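/- arXiv:1811.00190 — 8 statements merged into one kernel-verified Lean document; each statement's English description precedes it below -/
import Mathlib

section
/- Let γ > −1, μ = 1+γ, and let (a_{ij}) be an n×n real matrix with all entries nonnegative such that for each i there is j with a_{ij} > 0. Let v_1,…,v_n be C² functions on ℝ² with v_i ≤ 0, solving the entire Liouville system Δv_i + Σ_{j=1}^n a_{ij} |y|^{2γ} e^{v_j} = 0 in ℝ², with finite energies σ_i := (1/2π)∫_{ℝ²} |y|^{2γ} e^{v_i(y)} dy < ∞. Set m_i = Σ_{j=1}^n a_{ij} σ_j. Then for each i: (a) there is a constant C with |v_i(y) + m_i log|y|| ≤ C for all |y| ≥ 1; and (b) m_i > 2μ. -/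
open MeasureTheory Metric Filter

noncomputable section

/-- The plane `ℝ²`. -/
abbrev E2 := EuclideanSpace ℝ (Fin 2)

/-- The Laplacian of a function on the plane, as the sum of its pure second derivatives
in the coordinate directions. -/
def lap (f : E2 → ℝ) (x : E2) : ℝ :=
  ∑ i : Fin 2, fderiv ℝ (fun y => fderiv ℝ f y (EuclideanSpace.single i 1)) x
    (EuclideanSpace.single i 1)

/-- The truncated paraboloid `(1 - |w|²)₊`. -/
def tent (w : E2) : ℝ := max 0 (1 - ‖w‖ ^ 2)

lemma tent_nonneg (w : E2) : 0 ≤ tent w := le_max_left _ _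

lemma tent_le_one (w : E2) : tent w ≤ 1 :=
  max_le zero_le_one (by nlinarith [sq_nonneg ‖w‖])

lemma tent_eq_zero {w : E2} (hw : 1 ≤ ‖w‖) : tent w = 0 :=
  max_eq_left (by nlinarith)

lemma continuous_tent : Continuous tent := by
  unfold tent; fun_prop

lemma hasCompactSupport_tent : HasCompactSupport tent :=
  HasCompactSupport.intro (isCompact_closedBall (0 : E2) 1) fun w hw => by
    rw [mem_closedBall, dist_zero_right, not_le] at hw
    exact tent_eq_zero hw.le

lemma hasDerivAt_sq_max_zero (t : ℝ) :
    HasDerivAt (fun s : ℝ => (max 0 s) ^ 2) (2 * max 0 t) t := by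
  rcases lt_trichotomy t 0 with ht | rfl | ht
  · rw [max_eq_left ht.le, mul_zero]
    refine (hasDerivAt_const t (0 : ℝ)).congr_of_eventuallyEq ?_
    filter_upwards [Iio_mem_nhds ht] with s hs
    simp [max_eq_left (Set.mem_Iio.1 hs).le]
  · rw [hasDerivAt_iff_isLittleO]
    simp only [max_self, mul_zero, smul_zero, sub_zero, ne_eq, OfNat.ofNat_ne_zero,
      not_false_eq_true, zero_pow]
    refine Asymptotics.IsBigO.trans_isLittleO (g := fun s : ℝ => s ^ 2) ?_ ?_
    · refine Asymptotics.IsBigO.of_bound 1 (Eventually.of_forall fun s => ?_)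
      rw [one_mul, norm_pow, norm_pow]
      gcongr
      rcases le_total 0 s with h | h <;> simp [h]
    · simpa using Asymptotics.isLittleO_pow_id (𝕜 := ℝ) (n := 2) (by norm_num)
  · rw [max_eq_right ht.le]
    have h := (hasDerivAt_id t).pow 2
    simp only [id, Nat.cast_ofNat, Nat.add_one_sub_one, pow_one, mul_one] at h
    refine h.congr_of_eventuallyEq ?_
    filter_upwards [Ioi_mem_nhds ht] with s hs
    simp [max_eq_right (Set.mem_Ioi.1 hs).le]

lemma hasFDerivAt_tent_sq (w : E2) :
    HasFDerivAt (fun w => tent w ^ 2) ((-4 * tent w) • innerSL ℝ w) w := by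
  have h1 : HasFDerivAt (fun w : E2 => 1 - ‖w‖ ^ 2) (-(2 • innerSL ℝ w)) w :=
    (hasStrictFDerivAt_norm_sq w).hasFDerivAt.const_sub 1
  have h := (hasDerivAt_sq_max_zero (1 - ‖w‖ ^ 2)).comp_hasFDerivAt w h1
  have he : (-4 * tent w) • innerSL ℝ w = (2 * max 0 (1 - ‖w‖ ^ 2)) • -(2 • innerSL ℝ w) := by
    ext z
    simp [tent]
    ring
  rw [he]
  exact h

lemma integrable_tent_mul {g : E2 → ℝ} (hg : Continuous g) :
    Integrable fun w => tent w * g w :=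
  (continuous_tent.mul hg).integrable_of_hasCompactSupport hasCompactSupport_tent.mul_right

lemma integrable_tent_sq_mul {g : E2 → ℝ} (hg : Continuous g) :
    Integrable fun w => tent w ^ 2 * g w := by
  simpa only [pow_two, mul_assoc] using
    integrable_tent_mul (g := fun w => tent w * g w) (continuous_tent.mul hg)

lemma continuous_lap {u : E2 → ℝ} (hu : ContDiff ℝ 2 u) : Continuous (lap u) := by
  refine continuous_finsetSum _ fun i _ => ?_
  have h1 : ContDiff ℝ 1 fun y => fderiv ℝ u y (EuclideanSpace.single i 1) :=
    (hu.fderiv_right (m := 1) (by norm_num)).clm_apply contDiff_const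
  exact (h1.continuous_fderiv (by norm_num)).clm_apply continuous_const

lemma integral_tent_mul_coord {g : E2 → ℝ} (hg : ContDiff ℝ 1 g) (i : Fin 2) :
    ∫ w, tent w * (w i * g w) =
      ∫ w, tent w ^ 2 / 4 * fderiv ℝ g w (EuclideanSpace.single i 1) := by
  set e : E2 := EuclideanSpace.single i 1
  have hd (w : E2) : fderiv ℝ (fun w => tent w ^ 2) w e = tent w * (-4 * w i) := by
    rw [(hasFDerivAt_tent_sq w).fderiv]
    simp [e, EuclideanSpace.inner_single_right]
    ring
  have hc : Continuous fun w : E2 => -4 * w i := by fun_prop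
  have key := integral_mul_fderiv_eq_neg_fderiv_mul_of_integrable (μ := volume) (v := e)
    (f := fun w => tent w ^ 2) (g := g)
    (by simpa only [hd, mul_assoc] using
      integrable_tent_mul (g := fun w => -4 * w i * g w) (hc.mul hg.continuous))
    (integrable_tent_sq_mul ((hg.continuous_fderiv (by norm_num)).clm_apply continuous_const))
    (integrable_tent_sq_mul hg.continuous)
    (fun w _ => (hasFDerivAt_tent_sq w).differentiableAt)
    (fun w _ => hg.differentiable (by norm_num) w)
  have h2 (w : E2) : tent w ^ 2 / 4 * fderiv ℝ g w e = (1 / 4) * (tent w ^ 2 * fderiv ℝ g w e) := by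
    ring
  simp_rw [h2]
  rw [integral_const_mul, key, ← integral_neg, ← integral_const_mul]
  refine integral_congr_ae (Eventually.of_forall fun w => ?_)
  simp only [hd]
  ring

/-- The average of `u` over the disc of centre `y` and radius `r` with paraboloidal weight. -/
def ballMean (u : E2 → ℝ) (y : E2) (r : ℝ) : ℝ :=
  2 / Real.pi * ∫ w, tent w * u (y + r • w)

lemma integral_tent_fderiv {u : E2 → ℝ} (hu : ContDiff ℝ 2 u) (y : E2) (r : ℝ) :
    ∫ w, tent w * fderiv ℝ u (y + r • w) w = r * ∫ w, tent w ^ 2 / 4 * lap u (y + r • w) := by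
  have hu1 (i : Fin 2) : ContDiff ℝ 1 fun z => fderiv ℝ u z (EuclideanSpace.single i 1) :=
    (hu.fderiv_right (m := 1) (by norm_num)).clm_apply contDiff_const
  have hg (i : Fin 2) :
      ContDiff ℝ 1 fun w => fderiv ℝ u (y + r • w) (EuclideanSpace.single i 1) :=
    (hu1 i).comp (by fun_prop : ContDiff ℝ 1 fun w : E2 => y + r • w)
  have hdec (w : E2) : tent w * fderiv ℝ u (y + r • w) w =
      ∑ i, tent w * (w i * fderiv ℝ u (y + r • w) (EuclideanSpace.single i 1)) := by
    have hw : w = ∑ i, w i • (EuclideanSpace.single i 1 : E2) := by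
      ext j; fin_cases j <;> simp
    rw [← Finset.mul_sum]
    congr 1
    nth_rewrite 2 [hw]
    simp
  have hder (i : Fin 2) (w : E2) :
      fderiv ℝ (fun w => fderiv ℝ u (y + r • w) (EuclideanSpace.single i 1)) w
        (EuclideanSpace.single i 1) =
      r * fderiv ℝ (fun z => fderiv ℝ u z (EuclideanSpace.single i 1)) (y + r • w)
        (EuclideanSpace.single i 1) := by
    have h1 : HasFDerivAt (fun w : E2 => y + r • w) (r • ContinuousLinearMap.id ℝ E2) w :=
      ((hasFDerivAt_id w).const_smul r).const_add y
    have h2 := (((hu1 i).differentiable (by norm_num)) (y + r • w)).hasFDerivAt.comp w h1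
    have h3 := h2.fderiv
    rw [Function.comp_def] at h3
    rw [h3]
    simp
  simp_rw [hdec]
  rw [integral_finsetSum _ fun i _ => integrable_tent_mul (by
    have := (hg i).continuous; fun_prop)]
  simp_rw [integral_tent_mul_coord (hg _), hder]
  rw [← integral_finsetSum, ← integral_const_mul]
  · refine integral_congr_ae (Eventually.of_forall fun w => ?_)
    simp only [lap, Finset.mul_sum]
    exact Finset.sum_congr rfl fun i _ => by ring
  · intro i _
    have hc : Continuous fun w => fderiv ℝ (fun z => fderiv ℝ u z (EuclideanSpace.single i 1))
        (y + r • w) (EuclideanSpace.single i 1) :=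
      (((hu1 i).continuous_fderiv (by norm_num)).clm_apply continuous_const).comp
        (by fun_prop : Continuous fun w : E2 => y + r • w)
    simp_rw [div_mul_eq_mul_div]
    exact (integrable_tent_sq_mul (hc.const_mul r)).div_const 4

lemma hasDerivAt_ballMean {u : E2 → ℝ} (hu : ContDiff ℝ 2 u) (y : E2) (r : ℝ) :
    HasDerivAt (ballMean u y)
      (2 / Real.pi * (r * ∫ w, tent w ^ 2 / 4 * lap u (y + r • w))) r := by
  refine HasDerivAt.const_mul _ ?_
  rw [← integral_tent_fderiv hu]
  have hu1 : Continuous (fderiv ℝ u) := hu.continuous_fderiv (by norm_num)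
  obtain ⟨C, hC⟩ := ((isCompact_closedBall r 1).prod
    (isCompact_closedBall (0 : E2) 1)).exists_bound_of_continuousOn
      (f := fun p : ℝ × E2 => fderiv ℝ u (y + p.1 • p.2) p.2) (by fun_prop)
  have hcont (s : ℝ) : Continuous fun w : E2 => u (y + s • w) :=
    hu.continuous.comp (by fun_prop)
  refine (hasDerivAt_integral_of_dominated_loc_of_deriv_le (closedBall_mem_nhds r one_pos)
    (F' := fun s w => tent w * fderiv ℝ u (y + s • w) w) (bound := fun w => tent w * C)
    (Eventually.of_forall fun s => (continuous_tent.mul (hcont s)).aestronglyMeasurable)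
    (integrable_tent_mul (hcont r))
    (by
      have : Continuous fun w : E2 => fderiv ℝ u (y + r • w) w := by fun_prop
      exact (continuous_tent.mul this).aestronglyMeasurable)
    (Eventually.of_forall fun w s hs => ?_) (integrable_tent_mul continuous_const)
    (Eventually.of_forall fun w s _ => ?_)).2
  · rw [norm_mul, Real.norm_of_nonneg (tent_nonneg w)]
    rcases le_total 1 ‖w‖ with hw | hw
    · simp [tent_eq_zero hw]
    · exact mul_le_mul_of_nonneg_left (hC (s, w) ⟨hs, by simpa using hw⟩) (tent_nonneg w)
  · refine HasDerivAt.const_mul _ ?_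
    have h1 : HasDerivAt (fun s : ℝ => y + s • w) w s := by
      simpa using ((hasDerivAt_id s).smul_const w).const_add y
    exact ((hu.differentiable (by norm_num)) _).hasFDerivAt.comp_hasDerivAt s h1

lemma integral_tent : ∫ w, tent w = Real.pi / 2 := by
  have h := integral_fun_norm_addHaar (volume : Measure E2) fun t => max 0 (1 - t ^ 2)
  have hv : (volume : Measure E2).real (ball 0 1) = Real.pi := by
    simp [Measure.real, EuclideanSpace.volume_ball_fin_two, Real.pi_nonneg]
  have hI : ∫ t in Set.Ioi (0 : ℝ), t ^ (2 - 1) • max 0 (1 - t ^ 2) = 1 / 4 := by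
    rw [setIntegral_eq_of_subset_of_forall_sdiff_eq_zero (s := Set.Ioc 0 1) measurableSet_Ioi
      Set.Ioc_subset_Ioi_self, ← intervalIntegral.integral_of_le zero_le_one]
    · rw [intervalIntegral.integral_congr (g := fun t : ℝ => t - t ^ 3)]
      · rw [intervalIntegral.integral_sub (by simp) (by simp)]
        norm_num
      · intro t ht
        rw [Set.uIcc_of_le zero_le_one] at ht
        have : 0 ≤ 1 - t ^ 2 := by nlinarith [ht.1, ht.2]
        simp only [max_eq_right this, smul_eq_mul]
        ring
    · rintro t ⟨ht, ht'⟩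
      have h1 : 1 < t := by
        by_contra! h
        exact ht' ⟨ht, h⟩
      have : 1 - t ^ 2 ≤ 0 := by nlinarith
      simp [max_eq_left this]
  simp only [finrank_euclideanSpace, Fintype.card_fin, hv, hI] at h
  change ∫ w, max 0 (1 - ‖w‖ ^ 2) = _
  rw [h]
  simp
  ring

lemma ballMean_zero (u : E2 → ℝ) (y : E2) : ballMean u y 0 = u y := by
  simp only [ballMean, zero_smul, add_zero, integral_mul_const, integral_tent]
  field_simp

/-- The mass of `f` in the disc of centre `y` and radius `r`, with weight `(1 - |z-y|²/r²)₊²`,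
divided by `2π`. -/
def ballMass (f : E2 → ℝ) (y : E2) (r : ℝ) : ℝ :=
  1 / (2 * Real.pi) * ∫ z, tent (r⁻¹ • (z - y)) ^ 2 * f z

/-- The total mass of `f`, divided by `2π`. -/
def totalMass (f : E2 → ℝ) : ℝ := 1 / (2 * Real.pi) * ∫ z, f z

lemma integral_mul_comp_add_smul (h f : E2 → ℝ) (y : E2) {r : ℝ} (hr : 0 < r) :
    ∫ w, h w * f (y + r • w) = (r ^ 2)⁻¹ * ∫ z, h (r⁻¹ • (z - y)) * f z := by
  have h1 := Measure.integral_comp_smul (volume : Measure E2)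
    (fun x => h (r⁻¹ • x) * f (y + x)) r
  have h2 := integral_sub_right_eq_self (μ := (volume : Measure E2))
    (fun x => h (r⁻¹ • x) * f (y + x)) y
  simp only [inv_smul_smul₀ hr.ne', finrank_euclideanSpace, Fintype.card_fin, smul_eq_mul] at h1
  rw [h1, abs_of_pos (by positivity), ← h2]
  simp

lemma ballMean_eq (u : E2 → ℝ) (y : E2) {r : ℝ} (hr : 0 < r) :
    ballMean u y r = 2 / Real.pi * ((r ^ 2)⁻¹ * ∫ z, tent (r⁻¹ • (z - y)) * u z) := by
  rw [ballMean, integral_mul_comp_add_smul tent u y hr]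

lemma hasDerivAt_ballMean_of_pos {u : E2 → ℝ} (hu : ContDiff ℝ 2 u) (y : E2) {r : ℝ}
    (hr : 0 < r) : HasDerivAt (ballMean u y) (ballMass (lap u) y r / r) r := by
  have h := hasDerivAt_ballMean hu y r
  rw [integral_mul_comp_add_smul (fun w => tent w ^ 2 / 4) (lap u) y hr] at h
  simp_rw [div_mul_eq_mul_div, integral_div] at h
  convert h using 1
  rw [ballMass]
  field_simp
  ring

lemma sq_mul_tent_smul (y z : E2) {r : ℝ} (hr : 0 < r) :
    r ^ 2 * tent (r⁻¹ • (z - y)) = max 0 (r ^ 2 - ‖z - y‖ ^ 2) := by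
  rw [tent, norm_smul, norm_inv, Real.norm_of_nonneg hr.le, mul_max_of_nonneg _ _ (sq_nonneg r)]
  congr 1
  · simp
  · field_simp

lemma sq_mul_tent_le {y y' : E2} (z : E2) {r r' : ℝ} (hr : 0 < r) (h : r + ‖y - y'‖ ≤ r') :
    r ^ 2 * tent (r⁻¹ • (z - y)) ≤ r' ^ 2 * tent (r'⁻¹ • (z - y')) := by
  have hr' : 0 < r' := by linarith [norm_nonneg (y - y')]
  rw [sq_mul_tent_smul y z hr, sq_mul_tent_smul y' z hr']
  have htri : ‖z - y'‖ ≤ ‖z - y‖ + ‖y - y'‖ := norm_sub_le_norm_sub_add_norm_sub z y y'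
  rcases le_total r ‖z - y‖ with h1 | h1
  · rw [max_eq_left (by nlinarith)]
    exact le_max_left _ _
  · refine max_le_max le_rfl ?_
    have h2 : r - ‖z - y‖ ≤ r' - ‖z - y'‖ := by linarith
    have h3 : ‖z - y‖ + ‖z - y'‖ ≤ r + r' := by linarith
    have h4 := norm_nonneg (z - y)
    have h5 := norm_nonneg (z - y')
    have h6 : ‖z - y‖ + ‖y - y'‖ ≤ r' := by linarith
    have h7 := norm_nonneg (y - y')
    nlinarith

lemma integrable_tent_smul_mul {u : E2 → ℝ} (hu : Continuous u) (y : E2) {r : ℝ} (hr : 0 < r) :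
    Integrable fun z => tent (r⁻¹ • (z - y)) * u z := by
  have hc : Continuous fun z : E2 => tent (r⁻¹ • (z - y)) :=
    continuous_tent.comp (by fun_prop)
  refine (hc.mul hu).integrable_of_hasCompactSupport (HasCompactSupport.mul_right ?_)
  refine HasCompactSupport.intro (isCompact_closedBall y r) fun z hz => ?_
  rw [mem_closedBall, dist_eq_norm, not_le] at hz
  refine tent_eq_zero ?_
  rw [norm_smul, norm_inv, Real.norm_of_nonneg hr.le, inv_mul_eq_div, le_div_iff₀ hr]
  linarith

lemma integrable_tent_smul_sq_mul {f : E2 → ℝ} (hf : Integrable f) (y : E2) (r : ℝ) :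
    Integrable fun z => tent (r⁻¹ • (z - y)) ^ 2 * f z := by
  have hc : Continuous fun z : E2 => tent (r⁻¹ • (z - y)) ^ 2 :=
    (continuous_tent.comp (by fun_prop)).pow 2
  refine hf.bdd_mul (c := 1) hc.aestronglyMeasurable (Eventually.of_forall fun z => ?_)
  rw [Real.norm_of_nonneg (sq_nonneg _)]
  exact pow_le_one₀ (tent_nonneg _) (tent_le_one _)

lemma ballMean_nonneg {u : E2 → ℝ} (hu : ∀ y, 0 ≤ u y) (y : E2) (r : ℝ) :
    0 ≤ ballMean u y r :=
  mul_nonneg (div_nonneg zero_le_two Real.pi_nonneg)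
    (integral_nonneg fun w => mul_nonneg (tent_nonneg w) (hu _))

lemma ballMass_nonneg {f : E2 → ℝ} (hf : ∀ y, 0 ≤ f y) (y : E2) (r : ℝ) :
    0 ≤ ballMass f y r :=
  mul_nonneg (by positivity)
    (integral_nonneg fun w => mul_nonneg (sq_nonneg _) (hf _))

lemma ballMass_le_totalMass {f : E2 → ℝ} (hf : ∀ y, 0 ≤ f y) (hfi : Integrable f) (y : E2)
    (r : ℝ) : ballMass f y r ≤ totalMass f := by
  refine mul_le_mul_of_nonneg_left (integral_mono (integrable_tent_smul_sq_mul hfi y r) hfi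
    fun z => ?_) (by positivity)
  exact mul_le_of_le_one_left (hf z) (pow_le_one₀ (tent_nonneg _) (tent_le_one _))

lemma totalMass_nonneg {f : E2 → ℝ} (hf : ∀ y, 0 ≤ f y) : 0 ≤ totalMass f :=
  mul_nonneg (by positivity) (integral_nonneg hf)

lemma ballMean_le_ballMean {u : E2 → ℝ} (hu : Continuous u) (hu0 : ∀ y, 0 ≤ u y) {y y' : E2}
    {r r' : ℝ} (hr : 0 < r) (h : r + ‖y - y'‖ ≤ r') :
    r ^ 4 * ballMean u y r ≤ r' ^ 4 * ballMean u y' r' := by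
  have hr' : 0 < r' := by linarith [norm_nonneg (y - y')]
  have key : ∫ z, r ^ 2 * (tent (r⁻¹ • (z - y)) * u z) ≤
      ∫ z, r' ^ 2 * (tent (r'⁻¹ • (z - y')) * u z) := by
    refine integral_mono ((integrable_tent_smul_mul hu y hr).const_mul _)
      ((integrable_tent_smul_mul hu y' hr').const_mul _) fun z => ?_
    simp only [← mul_assoc]
    exact mul_le_mul_of_nonneg_right (sq_mul_tent_le z hr h) (hu0 z)
  rw [integral_const_mul, integral_const_mul] at key
  rw [ballMean_eq u y hr, ballMean_eq u y' hr']
  calc _ = 2 / Real.pi * (r ^ 2 * ∫ z, tent (r⁻¹ • (z - y)) * u z) := by field_simp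
    _ ≤ 2 / Real.pi * (r' ^ 2 * ∫ z, tent (r'⁻¹ • (z - y')) * u z) := by gcongr
    _ = _ := by field_simp

lemma ballMass_le_ballMass {f : E2 → ℝ} (hf : ∀ y, 0 ≤ f y) (hfi : Integrable f) {y y' : E2}
    {r r' : ℝ} (hr : 0 < r) (h : r + ‖y - y'‖ ≤ r') :
    r ^ 4 * ballMass f y r ≤ r' ^ 4 * ballMass f y' r' := by
  have key : ∫ z, r ^ 4 * (tent (r⁻¹ • (z - y)) ^ 2 * f z) ≤
      ∫ z, r' ^ 4 * (tent (r'⁻¹ • (z - y')) ^ 2 * f z) := by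
    refine integral_mono ((integrable_tent_smul_sq_mul hfi y r).const_mul _)
      ((integrable_tent_smul_sq_mul hfi y' r').const_mul _) fun z => ?_
    simp only [← mul_assoc]
    refine mul_le_mul_of_nonneg_right ?_ (hf z)
    have := pow_le_pow_left₀ (mul_nonneg (sq_nonneg r) (tent_nonneg _)) (sq_mul_tent_le z hr h) 2
    simpa only [mul_pow, ← pow_mul] using this
  rw [integral_const_mul, integral_const_mul] at key
  rw [ballMass, ballMass]
  calc _ = 1 / (2 * Real.pi) * (r ^ 4 * ∫ z, tent (r⁻¹ • (z - y)) ^ 2 * f z) := by ring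
    _ ≤ 1 / (2 * Real.pi) * (r' ^ 4 * ∫ z, tent (r'⁻¹ • (z - y')) ^ 2 * f z) := by gcongr
    _ = _ := by ring

lemma sub_le_sub_of_hasDerivAt_le {f g f' g' : ℝ → ℝ} {a b : ℝ} (hab : a ≤ b)
    (hf : ∀ x ∈ Set.Icc a b, HasDerivAt f (f' x) x)
    (hg : ∀ x ∈ Set.Icc a b, HasDerivAt g (g' x) x)
    (h : ∀ x ∈ Set.Icc a b, f' x ≤ g' x) : f b - f a ≤ g b - g a := by
  have hmono : MonotoneOn (fun x => g x - f x) (Set.Icc a b) := by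
    refine monotoneOn_of_hasDerivWithinAt_nonneg (f' := fun x => g' x - f' x) (convex_Icc a b)
      (fun x hx => ((hg x hx).sub (hf x hx)).continuousAt.continuousWithinAt)
      (fun x hx => ?_) (fun x hx => ?_)
    · have hx := interior_subset hx
      exact ((hg x hx).sub (hf x hx)).hasDerivWithinAt
    · exact sub_nonneg.2 (h x (interior_subset hx))
  have := hmono (Set.left_mem_Icc.2 hab) (Set.right_mem_Icc.2 hab) hab
  simp only at this
  linarith

lemma hasDerivAt_const_mul_log (K : ℝ) {x : ℝ} (hx : 0 < x) :
    HasDerivAt (fun x => K * Real.log x) (K / x) x := by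
  simpa only [div_eq_mul_inv] using (Real.hasDerivAt_log hx.ne').const_mul K

lemma sub_le_mul_log {φ N : ℝ → ℝ} (hφ : ∀ r, 0 < r → HasDerivAt φ (N r / r) r) {a b K : ℝ}
    (ha : 0 < a) (hab : a ≤ b) (h : ∀ r ∈ Set.Icc a b, N r ≤ K) :
    φ b - φ a ≤ K * Real.log b - K * Real.log a :=
  sub_le_sub_of_hasDerivAt_le hab (fun _ hx => hφ _ (ha.trans_le hx.1))
    (fun _ hx => hasDerivAt_const_mul_log K (ha.trans_le hx.1))
    fun _ hx => div_le_div_of_nonneg_right (h _ hx) (ha.trans_le hx.1).le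

lemma mul_log_le_sub {φ N : ℝ → ℝ} (hφ : ∀ r, 0 < r → HasDerivAt φ (N r / r) r) {a b K : ℝ}
    (ha : 0 < a) (hab : a ≤ b) (h : ∀ r ∈ Set.Icc a b, K ≤ N r) :
    K * Real.log b - K * Real.log a ≤ φ b - φ a :=
  sub_le_sub_of_hasDerivAt_le hab (fun _ hx => hasDerivAt_const_mul_log K (ha.trans_le hx.1))
    (fun _ hx => hφ _ (ha.trans_le hx.1))
    fun _ hx => div_le_div_of_nonneg_right (h _ hx) (ha.trans_le hx.1).le

/-- Comparison of two logarithmic primitives whose densities are comparable up to a shift. -/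
lemma le_add_of_shifted_density {φ ψ N Q : ℝ → ℝ} {m t : ℝ} (ht : 1 ≤ t)
    (hφ : ∀ r, 0 < r → HasDerivAt φ (N r / r) r) (hψ : ∀ r, 0 < r → HasDerivAt ψ (Q r / r) r)
    (hQ0 : ∀ r, 0 ≤ Q r) (hQm : ∀ r, Q r ≤ m)
    (hNQ : ∀ r, 0 < r → r ^ 4 * Q r ≤ (r + t) ^ 4 * N (r + t))
    (hφψ : ∀ r, 0 < r → r ^ 4 * φ r ≤ (r + t) ^ 4 * ψ (r + t)) (hψ0 : ∀ r, 0 ≤ ψ r) :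
    φ (2 * t) ≤ ψ t + 8 * m + 15 / (2 * t) * ψ (2 * t ^ 2 + t) := by
  have ht0 : 0 < t := by linarith
  have hm : 0 ≤ m := (hQ0 0).trans (hQm 0)
  set R := 2 * t ^ 2 with hR
  have hRt : 2 * t ≤ R := by nlinarith
  have step1 : ψ (R - t) - 10 * m * t * (-R⁻¹) - (ψ (2 * t - t) - 10 * m * t * (-(2 * t)⁻¹)) ≤
      φ R - φ (2 * t) := by
    refine sub_le_sub_of_hasDerivAt_le (f := fun r => ψ (r - t) - 10 * m * t * (-r⁻¹))
      (f' := fun r => Q (r - t) / (r - t) - 10 * m * t * (-(-(r ^ 2)⁻¹)))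
      (g' := fun r => N r / r) hRt (fun r hr => ?_) (fun r hr => hφ r (by linarith [hr.1]))
      (fun r hr => ?_)
    · exact ((hψ (r - t) (by linarith [hr.1])).comp_sub_const r t).sub
        ((hasDerivAt_inv (by linarith [hr.1])).neg.const_mul _)
    · obtain ⟨s, rfl⟩ : ∃ s, r = s + t := ⟨r - t, by ring⟩
      have hs : t ≤ s := by linarith [hr.1]
      have hs0 : 0 < s := by linarith
      have h1 := hNQ s hs0
      simp only [add_sub_cancel_right, neg_neg]
      have h2 : Q s * (s / (s + t)) ^ 5 / s ≤ N (s + t) / (s + t) := by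
        rw [div_le_div_iff₀ hs0 (by positivity), div_pow]
        field_simp
        linarith
      have h3 : 1 - 5 * (t / (s + t)) ≤ (s / (s + t)) ^ 5 := by
        have := one_add_mul_le_pow (a := -(t / (s + t)))
          (by
            have : t / (s + t) ≤ 1 := (div_le_one (by positivity)).2 (by linarith)
            linarith) 5
        have he : 1 + -(t / (s + t)) = s / (s + t) := by field_simp; ring
        rw [he] at this
        push_cast at this
        linarith
      have h4 : Q s / s - Q s * (s / (s + t)) ^ 5 / s ≤ Q s / s * (5 * (t / (s + t))) := by
        have : 0 ≤ Q s / s := div_nonneg (hQ0 s) hs0.le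
        have := mul_le_mul_of_nonneg_left h3 this
        have he : Q s * (s / (s + t)) ^ 5 / s = Q s / s * (s / (s + t)) ^ 5 := by ring
        rw [he]
        linarith
      have h5 : Q s / s * (5 * (t / (s + t))) ≤ 10 * m * t * ((s + t) ^ 2)⁻¹ := by
        calc Q s / s * (5 * (t / (s + t))) ≤ m / s * (5 * (t / (s + t))) := by
              gcongr; exact hQm s
          _ = 5 * m * t * (1 / (s * (s + t))) := by field_simp
          _ ≤ 5 * m * t * (2 * ((s + t) ^ 2)⁻¹) := by
              refine mul_le_mul_of_nonneg_left ?_ (by positivity)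
              rw [← div_eq_mul_inv, div_le_div_iff₀ (by positivity) (by positivity)]
              nlinarith
          _ = _ := by ring
      linarith
  have step2 : ψ (R + t) - ψ (R - t) ≤ m * Real.log (R + t) - m * Real.log (R - t) :=
    sub_le_mul_log hψ (by linarith) (by linarith) fun r _ => hQm r
  have step3 : m * Real.log (R + t) - m * Real.log (R - t) ≤ m * 2 := by
    rw [← mul_sub, ← Real.log_div (by positivity) (by linarith)]
    refine mul_le_mul_of_nonneg_left ?_ hm
    have h1 : (R + t) / (R - t) ≤ 3 := by
      rw [div_le_iff₀ (by linarith)]; linarith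
    have h2 : 0 < (R + t) / (R - t) := div_pos (by positivity) (by linarith)
    linarith [Real.log_le_sub_one_of_pos h2]
  have step4 : φ R ≤ ψ (R + t) + 15 / (2 * t) * ψ (R + t) := by
    have hR0 : 0 < R := by linarith
    have h1 := hφψ R hR0
    have h2 : (R + t) ^ 4 ≤ R ^ 4 * (1 + 15 / (2 * t)) := by
      have hx : t ≤ R := by linarith
      have h15 : (R + t) ^ 4 ≤ R ^ 4 + 15 * (R ^ 3 * t) := by
        have e1 : t ^ 2 * R ^ 2 ≤ R ^ 3 * t := by
          have := mul_le_mul_of_nonneg_left hx (by positivity : 0 ≤ t * R ^ 2)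
          nlinarith
        have e2 : t ^ 3 * R ≤ R ^ 3 * t := by
          have := mul_le_mul_of_nonneg_left (pow_le_pow_left₀ ht0.le hx 2)
            (by positivity : 0 ≤ t * R)
          nlinarith
        have e3 : t ^ 4 ≤ R ^ 3 * t := by
          have := mul_le_mul_of_nonneg_left (pow_le_pow_left₀ ht0.le hx 3) ht0.le
          nlinarith
        nlinarith
      have he : R ^ 4 * (1 + 15 / (2 * t)) = R ^ 4 + 15 * (R ^ 3 * t) := by
        rw [hR]; field_simp
      rw [he]; exact h15
    have h3 : R ^ 4 * φ R ≤ R ^ 4 * ((1 + 15 / (2 * t)) * ψ (R + t)) := by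
      rw [← mul_assoc]
      exact h1.trans (mul_le_mul_of_nonneg_right h2 (hψ0 _))
    have := le_of_mul_le_mul_left h3 (by positivity)
    linarith
  have step5 : 10 * m * t * (2 * t)⁻¹ = 5 * m := by field_simp; ring
  have step6 : 0 ≤ 10 * m * t * R⁻¹ := by positivity
  have e : 2 * t - t = t := by ring
  rw [e] at step1
  linarith

/-- Nonnegative subharmonic functions of class `C²` on the plane whose Laplacian has finite mass. -/
structure IsFiniteMassSubharmonic (u : E2 → ℝ) : Prop where
  contDiff : ContDiff ℝ 2 u
  nonneg : ∀ y, 0 ≤ u y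
  lap_nonneg : ∀ y, 0 ≤ lap u y
  integrable_lap : Integrable (lap u)

lemma tendsto_ballMass {f : E2 → ℝ} (hfi : Integrable f) :
    Tendsto (ballMass f 0) atTop (nhds (totalMass f)) := by
  refine Tendsto.const_mul _ ?_
  refine tendsto_integral_filter_of_dominated_convergence (fun z => ‖f z‖)
    (Eventually.of_forall fun r => (integrable_tent_smul_sq_mul hfi 0 r).aestronglyMeasurable)
    (Eventually.of_forall fun r => Eventually.of_forall fun z => ?_) hfi.norm
    (Eventually.of_forall fun z => ?_)
  · rw [norm_mul, Real.norm_of_nonneg (sq_nonneg _)]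
    exact mul_le_of_le_one_left (norm_nonneg _) (pow_le_one₀ (tent_nonneg _) (tent_le_one _))
  · have h1 : Tendsto (fun r : ℝ => r⁻¹ • (z - 0)) atTop (nhds ((0 : ℝ) • (z - 0))) :=
      tendsto_inv_atTop_zero.smul_const _
    rw [zero_smul] at h1
    have h2 := ((continuous_tent.tendsto 0).comp h1).pow 2
    simpa [tent] using h2.mul_const (f z)

lemma ballMass_add_le_totalMass {f : E2 → ℝ} (hf : ∀ y, 0 ≤ f y) (hfi : Integrable f) {y : E2}
    {r s : ℝ} (hr : 0 < r) (hs : 0 < s) (h : r + s ≤ ‖y‖) :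
    ballMass f y r + ballMass f 0 s ≤ totalMass f := by
  rw [ballMass, ballMass, totalMass, ← mul_add, ← integral_add (integrable_tent_smul_sq_mul hfi y r)
    (integrable_tent_smul_sq_mul hfi 0 s)]
  refine mul_le_mul_of_nonneg_left (integral_mono ((integrable_tent_smul_sq_mul hfi y r).add
    (integrable_tent_smul_sq_mul hfi 0 s)) hfi fun z => ?_) (by positivity)
  have hz {c : ℝ} (hc : 0 < c) {x : E2} (hx : c ≤ ‖z - x‖) : tent (c⁻¹ • (z - x)) = 0 := by
    refine tent_eq_zero ?_
    rwa [norm_smul, norm_inv, Real.norm_of_nonneg hc.le, inv_mul_eq_div, le_div_iff₀ hc, one_mul]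
  have h1 (w : E2) : tent w ^ 2 * f z ≤ f z :=
    mul_le_of_le_one_left (hf z) (pow_le_one₀ (tent_nonneg _) (tent_le_one _))
  change _ + _ ≤ _
  rcases le_total s ‖z - 0‖ with hs' | hs'
  · rw [hz hs hs', zero_pow two_ne_zero, zero_mul, add_zero]
    exact h1 _
  · have : r ≤ ‖z - y‖ := by
      have := norm_sub_norm_le y z
      rw [norm_sub_rev y z] at this
      rw [sub_zero] at hs'
      linarith
    rw [hz hr this, zero_pow two_ne_zero, zero_mul, zero_add]
    exact h1 _

namespace IsFiniteMassSubharmonic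

variable {u : E2 → ℝ}

lemma hasDerivAt (h : IsFiniteMassSubharmonic u) (y : E2) (r : ℝ) (hr : 0 < r) :
    HasDerivAt (ballMean u y) (ballMass (lap u) y r / r) r :=
  hasDerivAt_ballMean_of_pos h.contDiff y hr

lemma totalMass_nonneg (h : IsFiniteMassSubharmonic u) : 0 ≤ totalMass (lap u) :=
  _root_.totalMass_nonneg h.lap_nonneg

lemma ballMass_le (h : IsFiniteMassSubharmonic u) (y : E2) (r : ℝ) :
    ballMass (lap u) y r ≤ totalMass (lap u) :=
  ballMass_le_totalMass h.lap_nonneg h.integrable_lap y r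

lemma ballMean_mono (h : IsFiniteMassSubharmonic u) (y : E2) {a b : ℝ} (ha : 0 ≤ a)
    (hab : a ≤ b) : ballMean u y a ≤ ballMean u y b := by
  have := sub_le_sub_of_hasDerivAt_le hab (fun x _ => hasDerivAt_const x (0 : ℝ))
    (fun x _ => hasDerivAt_ballMean h.contDiff y x) fun x hx => by
      have : 0 ≤ ∫ w, tent w ^ 2 / 4 * lap u (y + x • w) := integral_nonneg fun w =>
        mul_nonneg (by positivity) (h.lap_nonneg _)
      have : 0 ≤ x := ha.trans hx.1
      positivity
  linarith

lemma ballMean_le_add_of_lap_le (h : IsFiniteMassSubharmonic u) (y : E2) {r S : ℝ} (hr : 0 ≤ r)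
    (hS : ∀ z, ‖z - y‖ ≤ r → lap u z ≤ S) : ballMean u y r ≤ u y + S * r ^ 2 / 8 := by
  have hS0 : 0 ≤ S := (h.lap_nonneg y).trans (hS y (by simpa using hr))
  have := sub_le_sub_of_hasDerivAt_le hr (fun x _ => hasDerivAt_ballMean h.contDiff y x)
    (g := fun x => S / 8 * x ^ 2) (g' := fun x => S / 8 * (2 * x))
    (fun x _ => by simpa using (hasDerivAt_pow 2 x).const_mul (S / 8)) fun x hx => by
      have hc : Continuous fun w : E2 => lap u (y + x • w) :=
        (continuous_lap h.contDiff).comp (by fun_prop)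
      have h1 : ∫ w, tent w ^ 2 / 4 * lap u (y + x • w) ≤ ∫ w, tent w * (S / 4) := by
        refine integral_mono ?_ (integrable_tent_mul continuous_const) fun w => ?_
        · simp_rw [div_mul_eq_mul_div]
          exact (integrable_tent_sq_mul hc).div_const 4
        · rcases le_total 1 ‖w‖ with hw | hw
          · simp [tent_eq_zero hw]
          · have h2 : lap u (y + x • w) ≤ S := hS _ (by
              rw [add_sub_cancel_left, norm_smul, Real.norm_of_nonneg hx.1]
              nlinarith [hx.1, hx.2, norm_nonneg w])
            have h3 := tent_nonneg w
            have h4 : tent w ^ 2 ≤ tent w := by nlinarith [tent_le_one w]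
            calc tent w ^ 2 / 4 * lap u (y + x • w) ≤ tent w / 4 * S :=
                  mul_le_mul (by linarith) h2 (h.lap_nonneg _) (by positivity)
              _ = _ := by ring
      rw [integral_mul_const, integral_tent] at h1
      calc 2 / Real.pi * (x * ∫ w, tent w ^ 2 / 4 * lap u (y + x • w))
          ≤ 2 / Real.pi * (x * (Real.pi / 2 * (S / 4))) := by
            have := hx.1
            gcongr
        _ = S / 8 * (2 * x) := by field_simp; ring
  rw [ballMean_zero] at this
  linarith

lemma ballMean_le_log (h : IsFiniteMassSubharmonic u) {r : ℝ} (hr : 1 ≤ r) :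
    ballMean u 0 r ≤ ballMean u 0 1 + totalMass (lap u) * Real.log r := by
  have := sub_le_mul_log (h.hasDerivAt 0) one_pos hr fun r _ => h.ballMass_le 0 r
  rw [Real.log_one] at this
  linarith

lemma ballMean_four_mul_sq_le (h : IsFiniteMassSubharmonic u) {t : ℝ} (ht : 1 ≤ t) :
    ballMean u 0 (4 * t ^ 2) ≤ (ballMean u 0 1 + 4 * totalMass (lap u)) * t := by
  have h1 := h.ballMean_le_log (r := 4 * t ^ 2) (by nlinarith)
  have h2 : Real.log (4 * t ^ 2) ≤ 4 * t := by
    have e : 4 * t ^ 2 = (2 * t) ^ 2 := by ring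
    rw [e, Real.log_pow]
    have := Real.log_le_sub_one_of_pos (show 0 < 2 * t by linarith)
    push_cast
    linarith
  have h3 := mul_le_mul_of_nonneg_left h2 h.totalMass_nonneg
  nlinarith [ballMean_nonneg h.nonneg 0 1]

lemma exists_le_ballMean_add (h : IsFiniteMassSubharmonic u) :
    ∃ C, ∀ y : E2, 1 ≤ ‖y‖ → u y ≤ ballMean u 0 ‖y‖ + C := by
  refine ⟨8 * totalMass (lap u) + 15 / 2 * (ballMean u 0 1 + 4 * totalMass (lap u)),
    fun y hy => ?_⟩
  have ht : 0 < ‖y‖ := by linarith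
  have key := le_add_of_shifted_density hy (h.hasDerivAt y) (h.hasDerivAt 0)
    (ballMass_nonneg h.lap_nonneg 0) (h.ballMass_le 0)
    (fun r hr => ballMass_le_ballMass h.lap_nonneg h.integrable_lap hr (by simp))
    (fun r hr => ballMean_le_ballMean h.contDiff.continuous h.nonneg hr (by simp))
    (ballMean_nonneg h.nonneg 0)
  have h1 : ballMean u 0 (2 * ‖y‖ ^ 2 + ‖y‖) ≤
      (ballMean u 0 1 + 4 * totalMass (lap u)) * ‖y‖ :=
    (h.ballMean_mono 0 (by positivity) (by nlinarith)).trans (h.ballMean_four_mul_sq_le hy)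
  have h2 : 15 / (2 * ‖y‖) * ballMean u 0 (2 * ‖y‖ ^ 2 + ‖y‖) ≤
      15 / 2 * (ballMean u 0 1 + 4 * totalMass (lap u)) := by
    calc _ ≤ 15 / (2 * ‖y‖) * ((ballMean u 0 1 + 4 * totalMass (lap u)) * ‖y‖) := by gcongr
      _ = _ := by field_simp
  have h3 := h.ballMean_mono y le_rfl (show 0 ≤ 2 * ‖y‖ by positivity)
  rw [ballMean_zero] at h3
  linarith

lemma exists_ballMean_zero_le (h : IsFiniteMassSubharmonic u) :
    ∃ C, ∀ y : E2, 1 ≤ ‖y‖ → ballMean u 0 ‖y‖ ≤ ballMean u y (‖y‖ / 2) + C := by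
  refine ⟨9 * totalMass (lap u) + 120 * (ballMean u 0 1 + 4 * totalMass (lap u)),
    fun y hy => ?_⟩
  have ht : 0 < ‖y‖ := by linarith
  have key := le_add_of_shifted_density hy (h.hasDerivAt 0) (h.hasDerivAt y)
    (ballMass_nonneg h.lap_nonneg y) (h.ballMass_le y)
    (fun r hr => ballMass_le_ballMass h.lap_nonneg h.integrable_lap hr (by simp))
    (fun r hr => ballMean_le_ballMean h.contDiff.continuous h.nonneg hr (by simp))
    (ballMean_nonneg h.nonneg y)
  have h0 : ballMean u y (2 * ‖y‖ ^ 2 + ‖y‖) ≤ 16 * ballMean u 0 (4 * ‖y‖ ^ 2) := by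
    set s := 2 * ‖y‖ ^ 2 + ‖y‖ with hs
    have hs0 : 0 < s := by positivity
    have e1 : ballMean u 0 (s + ‖y‖) ≤ ballMean u 0 (4 * ‖y‖ ^ 2) :=
      h.ballMean_mono 0 (by positivity) (by nlinarith)
    have e2 := ballMean_le_ballMean h.contDiff.continuous h.nonneg (y := y) (y' := 0) hs0
      (r' := s + ‖y‖) (by simp)
    have e3 : (s + ‖y‖) ^ 4 ≤ s ^ 4 * 16 := by
      calc (s + ‖y‖) ^ 4 ≤ (2 * s) ^ 4 := by
            gcongr
            nlinarith
        _ = _ := by ring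
    refine le_of_mul_le_mul_left (a := s ^ 4) ?_ (by positivity)
    calc _ ≤ _ := e2
      _ ≤ s ^ 4 * 16 * ballMean u 0 (4 * ‖y‖ ^ 2) :=
        mul_le_mul e3 e1 (ballMean_nonneg h.nonneg _ _) (by positivity)
      _ = _ := by ring
  have h2 : 15 / (2 * ‖y‖) * ballMean u y (2 * ‖y‖ ^ 2 + ‖y‖) ≤
      120 * (ballMean u 0 1 + 4 * totalMass (lap u)) := by
    calc _ ≤ 15 / (2 * ‖y‖) * (16 * ((ballMean u 0 1 + 4 * totalMass (lap u)) * ‖y‖)) := by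
          gcongr
          linarith [h.ballMean_four_mul_sq_le hy]
      _ = _ := by field_simp; ring
  have h3 := h.ballMean_mono 0 ht.le (show ‖y‖ ≤ 2 * ‖y‖ by linarith)
  have h4 := sub_le_mul_log (h.hasDerivAt y) (half_pos ht) (half_le_self ht.le)
    fun r _ => h.ballMass_le y r
  rw [Real.log_div ht.ne' two_ne_zero] at h4
  have h5 := mul_le_mul_of_nonneg_left (Real.log_two_lt_d9.le.trans (by norm_num : _ ≤ (1 : ℝ)))
    h.totalMass_nonneg
  linarith

/-- Almost sharp logarithmic lower bound, assuming that the Laplacian grows at most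
polynomially. -/
lemma exists_sub_mul_log_le (h : IsFiniteMassSubharmonic u) {K p : ℝ} (hK : 0 ≤ K) (hp : 0 ≤ p)
    (hf : ∀ y : E2, 1 ≤ ‖y‖ → lap u y ≤ K * ‖y‖ ^ p) {ε : ℝ} (hε : 0 < ε) :
    ∃ C, ∀ y : E2, 1 ≤ ‖y‖ → (totalMass (lap u) - ε) * Real.log ‖y‖ ≤ u y + C := by
  obtain ⟨C₁, hC₁⟩ := h.exists_ballMean_zero_le
  set m := totalMass (lap u) with hm
  have hm0 : 0 ≤ m := h.totalMass_nonneg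
  set η := ε / (p + 2) with hη
  have hη0 : 0 < η := by positivity
  obtain ⟨R, hR⟩ := eventually_atTop.1
    ((tendsto_ballMass h.integrable_lap).eventually (lt_mem_nhds (sub_lt_self m hη0)))
  set R₁ := max R 1 with hR₁
  have hR₁1 : 1 ≤ R₁ := le_max_right _ _
  have hmass {r : ℝ} (hr : R₁ ≤ r) : m - η ≤ ballMass (lap u) 0 r :=
    (hR r ((le_max_left _ _).trans hr)).le
  have hlogR : 0 ≤ Real.log (2 * R₁) := Real.log_nonneg (by linarith)
  refine ⟨m * Real.log (2 * R₁) + |C₁| + K * 2 ^ p / 8, fun y hy => ?_⟩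
  set t := ‖y‖ with ht
  have ht0 : 0 < t := by linarith
  have hlog : 0 ≤ Real.log t := Real.log_nonneg hy
  have hK2 : 0 ≤ K * 2 ^ p / 8 := by positivity
  rcases le_total t (2 * R₁) with htR | htR
  · have h1 : Real.log t ≤ Real.log (2 * R₁) := Real.log_le_log ht0 htR
    have h2 := mul_le_mul_of_nonneg_left h1 hm0
    nlinarith [h.nonneg y, abs_nonneg C₁]
  · set r₀ := t ^ (-p) with hr₀
    have hr₀0 : 0 < r₀ := Real.rpow_pos_of_pos ht0 _
    have hr₀1 : r₀ ≤ 1 := Real.rpow_le_one_of_one_le_of_nonpos hy (by linarith)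
    have hr₀t : r₀ ≤ t / 2 := by linarith
    have e1 : ballMean u y r₀ ≤ u y + K * 2 ^ p / 8 := by
      have := h.ballMean_le_add_of_lap_le y (r := r₀) (S := K * (2 * t) ^ p) hr₀0.le
        fun z hz => by
          have z1 := norm_sub_norm_le y z
          have z2 := norm_sub_norm_le z y
          rw [norm_sub_rev y z] at z1
          refine (hf z (by linarith)).trans ?_
          gcongr
          linarith
      have e : K * (2 * t) ^ p * r₀ ^ 2 ≤ K * 2 ^ p := by
        rw [Real.mul_rpow zero_le_two ht0.le, pow_two]
        have e' : t ^ p * r₀ = 1 := by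
          rw [hr₀, ← Real.rpow_add ht0]; simp
        calc K * (2 ^ p * t ^ p) * (r₀ * r₀) = K * 2 ^ p * (t ^ p * r₀) * r₀ := by ring
          _ = K * 2 ^ p * r₀ := by rw [e', mul_one]
          _ ≤ _ := mul_le_of_le_one_right (by positivity) hr₀1
      linarith
    have e2 := sub_le_mul_log (K := η) (h.hasDerivAt y) hr₀0 hr₀t fun r hr => by
      have a1 := ballMass_add_le_totalMass h.lap_nonneg h.integrable_lap (y := y) (r := r)
        (s := t / 2) (hr₀0.trans_le hr.1) (by linarith) (by linarith [hr.2])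
      have a2 := hmass (r := t / 2) (by linarith)
      linarith
    have e3 : η * Real.log (t / 2) - η * Real.log r₀ ≤ η * (1 + p) * Real.log t := by
      rw [hr₀, Real.log_rpow ht0]
      have := mul_le_mul_of_nonneg_left
        (Real.log_le_log (half_pos ht0) (half_le_self ht0.le)) hη0.le
      linarith
    have e4 := mul_log_le_sub (K := m - η) (h.hasDerivAt 0) (a := R₁) (b := t) (by linarith)
      (by linarith) fun r hr => hmass hr.1
    have e5 : (m - η) * Real.log R₁ ≤ m * Real.log (2 * R₁) := by
      have a1 : Real.log R₁ ≤ Real.log (2 * R₁) := Real.log_le_log (by linarith) (by linarith)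
      have a2 : 0 ≤ Real.log R₁ := Real.log_nonneg hR₁1
      nlinarith
    have e6 : ε * Real.log t = η * (p + 2) * Real.log t := by
      rw [hη]; field_simp
    have e7 := ballMean_nonneg h.nonneg 0 R₁
    have e8 := hC₁ y hy
    have e9 := le_abs_self C₁
    nlinarith

lemma integrable_rpow_norm_mul_lap (h : IsFiniteMassSubharmonic u) {K δ : ℝ} (hδ : 0 < δ)
    (hf : ∀ y : E2, 1 ≤ ‖y‖ → lap u y ≤ K * ‖y‖ ^ (-(2 + δ))) :
    Integrable fun z => ‖z‖ ^ (δ / 2) * lap u z := by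
  have hc : Continuous fun z : E2 => ‖z‖ ^ (δ / 2) * lap u z :=
    (continuous_norm.rpow_const fun _ => Or.inr (by positivity)).mul (continuous_lap h.contDiff)
  obtain ⟨S, hS⟩ := (isCompact_closedBall (0 : E2) 1).exists_bound_of_continuousOn hc.continuousOn
  have hint := integrable_one_add_norm (E := E2) (μ := volume) (r := 2 + δ / 2) (by
    simp only [finrank_euclideanSpace, Fintype.card_fin, Nat.cast_ofNat]; linarith)
  set B := |K| + |S| with hB
  refine (hint.const_mul (B * 2 ^ (2 + δ / 2))).mono' hc.aestronglyMeasurable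
    (Eventually.of_forall fun z => ?_)
  have hz0 : 0 < 1 + ‖z‖ := by positivity
  rcases le_total ‖z‖ 1 with hz | hz
  · have h1 : (1 : ℝ) ≤ 2 ^ (2 + δ / 2) * (1 + ‖z‖) ^ (-(2 + δ / 2)) := by
      rw [Real.rpow_neg hz0.le, ← div_eq_mul_inv, one_le_div (by positivity)]
      exact Real.rpow_le_rpow hz0.le (by linarith) (by positivity)
    calc ‖‖z‖ ^ (δ / 2) * lap u z‖ ≤ S := hS z (by simpa using hz)
      _ ≤ B := by linarith [le_abs_self S, abs_nonneg K]
      _ ≤ B * (2 ^ (2 + δ / 2) * (1 + ‖z‖) ^ (-(2 + δ / 2))) :=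
        le_mul_of_one_le_right (by positivity) h1
      _ = _ := by ring
  · have hz1 : 0 < ‖z‖ := by linarith
    have h1 : ‖z‖ ^ (-(2 + δ / 2)) ≤ 2 ^ (2 + δ / 2) * (1 + ‖z‖) ^ (-(2 + δ / 2)) := by
      rw [Real.rpow_neg hz0.le, Real.rpow_neg hz1.le, ← div_eq_mul_inv, inv_eq_one_div,
        div_le_div_iff₀ (by positivity) (by positivity), one_mul,
        ← Real.mul_rpow zero_le_two hz1.le]
      exact Real.rpow_le_rpow hz0.le (by linarith) (by positivity)
    rw [Real.norm_of_nonneg (mul_nonneg (by positivity) (h.lap_nonneg z))]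
    calc ‖z‖ ^ (δ / 2) * lap u z ≤ ‖z‖ ^ (δ / 2) * (K * ‖z‖ ^ (-(2 + δ))) :=
          mul_le_mul_of_nonneg_left (hf z hz) (by positivity)
      _ = K * ‖z‖ ^ (-(2 + δ / 2)) := by
        rw [mul_left_comm, ← Real.rpow_add hz1]; ring_nf
      _ ≤ B * ‖z‖ ^ (-(2 + δ / 2)) := by
        gcongr
        linarith [le_abs_self K, abs_nonneg S]
      _ ≤ B * (2 ^ (2 + δ / 2) * (1 + ‖z‖) ^ (-(2 + δ / 2))) := by gcongr
      _ = _ := by ring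

lemma one_sub_tent_sq_le {η : ℝ} (hη0 : 0 < η) (hη2 : η ≤ 2) (w : E2) :
    1 - tent w ^ 2 ≤ 2 * ‖w‖ ^ η := by
  rcases le_total 1 ‖w‖ with hw | hw
  · have := Real.one_le_rpow hw hη0.le
    rw [tent_eq_zero hw]
    linarith
  · have h0 := norm_nonneg w
    have h1 : 1 - ‖w‖ ^ 2 ≤ tent w := le_max_right _ _
    have h2 : ‖w‖ ^ 2 ≤ ‖w‖ ^ η := by
      rcases h0.eq_or_lt with h | h
      · rw [← h, zero_pow two_ne_zero]
        positivity
      · rw [← Real.rpow_two]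
        exact Real.rpow_le_rpow_of_exponent_ge h hw hη2
    have h3 := tent_le_one w
    have h4 : (1 - ‖w‖ ^ 2) ^ 2 ≤ tent w ^ 2 :=
      pow_le_pow_left₀ (by nlinarith) h1 2
    nlinarith [sq_nonneg (‖w‖ ^ 2)]

lemma exists_totalMass_sub_le (h : IsFiniteMassSubharmonic u) {K δ : ℝ} (hδ : 0 < δ)
    (hδ1 : δ ≤ 1) (hf : ∀ y : E2, 1 ≤ ‖y‖ → lap u y ≤ K * ‖y‖ ^ (-(2 + δ))) :
    ∃ B, 0 ≤ B ∧ ∀ r, 0 < r →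
      totalMass (lap u) - B * r ^ (-(δ / 2)) ≤ ballMass (lap u) 0 r := by
  have hint := h.integrable_rpow_norm_mul_lap hδ hf
  refine ⟨1 / (2 * Real.pi) * (2 * ∫ z, ‖z‖ ^ (δ / 2) * lap u z), ?_, fun r hr => ?_⟩
  · have : 0 ≤ ∫ z, ‖z‖ ^ (δ / 2) * lap u z :=
      integral_nonneg fun z => mul_nonneg (by positivity) (h.lap_nonneg z)
    positivity
  · have key : ∫ z, lap u z ≤ ∫ z, (tent (r⁻¹ • (z - 0)) ^ 2 * lap u z +
        2 * r ^ (-(δ / 2)) * (‖z‖ ^ (δ / 2) * lap u z)) := by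
      refine integral_mono h.integrable_lap
        ((integrable_tent_smul_sq_mul h.integrable_lap 0 r).add (hint.const_mul _)) fun z => ?_
      have h1 := one_sub_tent_sq_le (η := δ / 2) (by positivity) (by linarith) (r⁻¹ • (z - 0))
      have h2 : ‖r⁻¹ • (z - 0)‖ ^ (δ / 2) = r ^ (-(δ / 2)) * ‖z‖ ^ (δ / 2) := by
        rw [sub_zero, norm_smul, norm_inv, Real.norm_of_nonneg hr.le,
          Real.mul_rpow (by positivity) (norm_nonneg z), Real.inv_rpow hr.le, Real.rpow_neg hr.le]
      rw [h2] at h1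
      have h3 := mul_le_mul_of_nonneg_right h1 (h.lap_nonneg z)
      change _ ≤ _ + _
      linarith
    rw [integral_add (integrable_tent_smul_sq_mul h.integrable_lap 0 r) (hint.const_mul _),
      integral_const_mul] at key
    have h4 := mul_le_mul_of_nonneg_left key (by positivity : 0 ≤ 1 / (2 * Real.pi))
    rw [totalMass, ballMass]
    linarith

/-- Sharp logarithmic lower bound, assuming that the Laplacian decays faster than `|y|⁻²`. -/
lemma exists_mul_log_le (h : IsFiniteMassSubharmonic u) {K δ : ℝ} (hδ : 0 < δ)
    (hδ1 : δ ≤ 1) (hf : ∀ y : E2, 1 ≤ ‖y‖ → lap u y ≤ K * ‖y‖ ^ (-(2 + δ))) :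
    ∃ C, ∀ y : E2, 1 ≤ ‖y‖ → totalMass (lap u) * Real.log ‖y‖ ≤ u y + C := by
  obtain ⟨C₁, hC₁⟩ := h.exists_ballMean_zero_le
  obtain ⟨B, hB0, hB⟩ := h.exists_totalMass_sub_le hδ hδ1 hf
  set m := totalMass (lap u) with hm
  have hm0 : 0 ≤ m := h.totalMass_nonneg
  refine ⟨m + |C₁| + B / (δ / 2) + |K| / 8, fun y hy => ?_⟩
  set t := ‖y‖ with ht
  have ht0 : 0 < t := by linarith
  have hBδ : 0 ≤ B / (δ / 2) := by positivity
  rcases le_total t 2 with ht2 | ht2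
  · have h1 : Real.log t ≤ 1 := by linarith [Real.log_le_sub_one_of_pos ht0]
    nlinarith [h.nonneg y, abs_nonneg C₁, abs_nonneg K]
  · have e1 : ballMean u y (t / 2) ≤ u y + |K| / 8 := by
      have hs : 0 < t / 2 := by positivity
      have := h.ballMean_le_add_of_lap_le y (r := t / 2) (S := |K| * (t / 2) ^ (-(2 + δ)))
        hs.le fun z hz => by
          have z1 := norm_sub_norm_le y z
          rw [norm_sub_rev y z] at z1
          have hz1 : t / 2 ≤ ‖z‖ := by linarith
          refine (hf z (by linarith)).trans ?_
          refine mul_le_mul (le_abs_self K) ?_ (by positivity) (abs_nonneg K)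
          exact Real.rpow_le_rpow_of_nonpos hs hz1 (by linarith)
      have e : |K| * (t / 2) ^ (-(2 + δ)) * (t / 2) ^ 2 ≤ |K| := by
        rw [mul_assoc, ← Real.rpow_two, ← Real.rpow_add hs]
        refine mul_le_of_le_one_right (abs_nonneg K) ?_
        exact Real.rpow_le_one_of_one_le_of_nonpos (by linarith) (by linarith)
      linarith
    have e2 := sub_le_sub_of_hasDerivAt_le hy
      (f := fun r => m * Real.log r + B / (δ / 2) * r ^ (-(δ / 2)))
      (f' := fun r => m / r + B / (δ / 2) * (-(δ / 2) * r ^ (-(δ / 2) - 1)))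
      (fun r hr => (hasDerivAt_const_mul_log m (by linarith [hr.1])).add
        ((Real.hasDerivAt_rpow_const (Or.inl (by linarith [hr.1]))).const_mul _))
      (fun r hr => h.hasDerivAt 0 r (by linarith [hr.1])) fun r hr => by
        have hr0 : 0 < r := by linarith [hr.1]
        have h1 := div_le_div_of_nonneg_right (hB r hr0) hr0.le
        rw [Real.rpow_sub_one hr0.ne']
        refine le_trans (le_of_eq ?_) h1
        field_simp
        ring
    simp only [Real.log_one, mul_zero, Real.one_rpow, mul_one, zero_add] at e2
    have e3 : 0 ≤ B / (δ / 2) * t ^ (-(δ / 2)) := by positivity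
    have e4 := hC₁ y hy
    have e5 := le_abs_self C₁
    have e6 := ballMean_nonneg h.nonneg 0 1
    linarith

lemma exists_le_mul_log (h : IsFiniteMassSubharmonic u) :
    ∃ C, ∀ y : E2, 1 ≤ ‖y‖ → u y ≤ totalMass (lap u) * Real.log ‖y‖ + C := by
  obtain ⟨C, hC⟩ := h.exists_le_ballMean_add
  refine ⟨ballMean u 0 1 + C, fun y hy => ?_⟩
  linarith [hC y hy, h.ballMean_le_log hy]

end IsFiniteMassSubharmonic

lemma two_mul_one_add_lt_of_integrable {u : E2 → ℝ} {γ m C : ℝ}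
    (hint : Integrable fun y : E2 => ‖y‖ ^ (2 * γ) * Real.exp (-u y))
    (hu : ∀ y : E2, 1 ≤ ‖y‖ → u y ≤ m * Real.log ‖y‖ + C) : 2 * (1 + γ) < m := by
  set g : ℝ → ℝ := (Set.Ioi 1).indicator fun s => s ^ (2 * γ - m) with hg
  have hgm : Measurable g := (by fun_prop : Measurable fun s : ℝ => s ^ (2 * γ - m)).indicator
    measurableSet_Ioi
  have h1 : Integrable fun y : E2 => g ‖y‖ := by
    refine (hint.const_mul (Real.exp C)).mono' (hgm.comp measurable_norm).aestronglyMeasurable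
      (Eventually.of_forall fun y => ?_)
    by_cases hy : 1 < ‖y‖
    · have hy0 : 0 < ‖y‖ := by linarith
      rw [hg, Set.indicator_of_mem (Set.mem_Ioi.2 hy), Real.norm_of_nonneg (by positivity),
        sub_eq_add_neg, Real.rpow_add hy0, mul_left_comm, ← Real.exp_add]
      refine mul_le_mul_of_nonneg_left ?_ (by positivity)
      rw [Real.rpow_def_of_pos hy0, Real.exp_le_exp]
      linarith [hu y hy.le]
    · rw [hg, Set.indicator_of_notMem (by simpa using hy), norm_zero]
      positivity
  rw [integrable_fun_norm_addHaar] at h1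
  have h2 := h1.mono_set (Set.Ioi_subset_Ioi zero_le_one)
  have h3 : IntegrableOn (fun s : ℝ => s ^ (2 * γ - m + 1)) (Set.Ioi 1) := by
    refine h2.congr_fun (fun s hs => ?_) measurableSet_Ioi
    have hs0 : 0 < s := zero_lt_one.trans hs
    simp only [finrank_euclideanSpace, Fintype.card_fin, hg, Set.indicator_of_mem hs, smul_eq_mul]
    rw [Real.rpow_add_one hs0.ne']
    ring
  rw [integrableOn_Ioi_rpow_iff one_pos] at h3
  linarith

lemma lap_neg (f : E2 → ℝ) (x : E2) : lap (fun y => -f y) x = -lap f x := by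
  simp [lap, fderiv_fun_neg]

/-- for nonpositive entire solutions of the singular Liouville system
`Δvᵢ + Σⱼ aᵢⱼ |y|^{2γ} e^{vⱼ} = 0` in `ℝ²` with finite energies
`σᵢ = (1/2π)∫_{ℝ²} |y|^{2γ} e^{vᵢ}`, each component has the logarithmic behavior
`vᵢ(y) = −mᵢ log|y| + O(1)` for `|y| ≥ 1`, where `mᵢ = Σⱼ aᵢⱼ σⱼ`, and `mᵢ > 2μ`
with `μ = 1 + γ`. -/
theorem entire_solution_log_decay {n : ℕ} (γ : ℝ) (hγ : -1 < γ)
    (A : Matrix (Fin n) (Fin n) ℝ)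
    (hA_nonneg : ∀ i j, 0 ≤ A i j) (hA_row : ∀ i, ∃ j, 0 < A i j)
    (v : Fin n → E2 → ℝ)
    (hv_c2 : ∀ i, ContDiff ℝ 2 (v i))
    (hv_nonpos : ∀ i y, v i y ≤ 0)
    (pde : ∀ i, ∀ y : E2, lap (v i) y + ∑ j, A i j * (‖y‖ ^ (2*γ) * Real.exp (v j y)) = 0)
    (hint : ∀ i, Integrable (fun y : E2 => ‖y‖ ^ (2*γ) * Real.exp (v i y)))
    (σ : Fin n → ℝ)
    (hσ : ∀ i, σ i = (1/(2*Real.pi)) * ∫ y : E2, ‖y‖ ^ (2*γ) * Real.exp (v i y))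
    (m : Fin n → ℝ) (hm : ∀ i, m i = ∑ j, A i j * σ j) :
    ∀ i, (∃ C : ℝ, ∀ y : E2, 1 ≤ ‖y‖ → |v i y + m i * Real.log ‖y‖| ≤ C) ∧
      2*(1+γ) < m i := by
  have hu_lap (i : Fin n) (y : E2) : lap (fun z => -v i z) y =
      ∑ j, A i j * (‖y‖ ^ (2 * γ) * Real.exp (v j y)) := by
    rw [lap_neg]
    linarith [pde i y]
  have hu_int (i : Fin n) : Integrable (lap fun z => -v i z) := by
    rw [funext (hu_lap i)]
    exact integrable_finsetSum _ fun j _ => (hint j).const_mul _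
  have hu (i : Fin n) : IsFiniteMassSubharmonic fun z => -v i z :=
    { contDiff := (hv_c2 i).neg
      nonneg := fun y => neg_nonneg.2 (hv_nonpos i y)
      lap_nonneg := fun y => by
        rw [hu_lap]
        exact Finset.sum_nonneg fun j _ => mul_nonneg (hA_nonneg i j) (by positivity)
      integrable_lap := hu_int i }
  have hu_mass (i : Fin n) : totalMass (lap fun z => -v i z) = m i := by
    rw [totalMass, funext (hu_lap i), integral_finsetSum _ fun j _ => (hint j).const_mul _, hm,
      Finset.mul_sum]
    refine Finset.sum_congr rfl fun j _ => ?_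
    rw [integral_const_mul, hσ]
    ring
  have hupper (i : Fin n) : ∃ C, ∀ y : E2, 1 ≤ ‖y‖ → -v i y ≤ m i * Real.log ‖y‖ + C :=
    hu_mass i ▸ (hu i).exists_le_mul_log
  have hm_lt (i : Fin n) : 2 * (1 + γ) < m i := by
    obtain ⟨C, hC⟩ := hupper i
    exact two_mul_one_add_lt_of_integrable (by simpa only [neg_neg] using hint i) hC
  obtain ⟨δ, hδ0, hδ1, hδm⟩ : ∃ δ, 0 < δ ∧ δ ≤ 1 ∧ ∀ j, 2 * (1 + γ) + 2 * δ ≤ m j := by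
    have h1 (j : Fin n) : ∀ᶠ δ in nhdsWithin (0 : ℝ) (Set.Ioi 0), 2 * (1 + γ) + 2 * δ ≤ m j := by
      have hc : Tendsto (fun δ : ℝ => 2 * (1 + γ) + 2 * δ) (nhds 0)
          (nhds (2 * (1 + γ) + 2 * 0)) := by
        have : Continuous fun δ : ℝ => 2 * (1 + γ) + 2 * δ := by fun_prop
        exact this.tendsto 0
      rw [mul_zero, add_zero] at hc
      exact ((hc.eventually (gt_mem_nhds (hm_lt j))).filter_mono nhdsWithin_le_nhds).mono
        fun _ h => le_of_lt h
    obtain ⟨δ, hδ, hδ'⟩ := ((eventually_all.2 h1).and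
      (Ioc_mem_nhdsGT (zero_lt_one' ℝ))).exists
    exact ⟨δ, hδ'.1, hδ'.2, hδ⟩
  have hcrude (j : Fin n) : ∃ C, ∀ y : E2, 1 ≤ ‖y‖ → (m j - δ) * Real.log ‖y‖ ≤ -v j y + C := by
    rw [← hu_mass j]
    refine (hu j).exists_sub_mul_log_le (K := ∑ k, A j k) (p := 2 * |γ|)
      (Finset.sum_nonneg fun k _ => hA_nonneg j k) (by positivity) (fun y hy => ?_) hδ0
    rw [hu_lap, Finset.sum_mul]
    refine Finset.sum_le_sum fun k _ => mul_le_mul_of_nonneg_left ?_ (hA_nonneg j k)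
    calc ‖y‖ ^ (2 * γ) * Real.exp (v k y) ≤ ‖y‖ ^ (2 * γ) :=
          mul_le_of_le_one_right (by positivity) (Real.exp_le_one_iff.2 (hv_nonpos k y))
      _ ≤ ‖y‖ ^ (2 * |γ|) := Real.rpow_le_rpow_of_exponent_le hy (by linarith [le_abs_self γ])
  choose C hC using hcrude
  intro i
  refine ⟨?_, hm_lt i⟩
  have hdecay (y : E2) (hy : 1 ≤ ‖y‖) :
      lap (fun z => -v i z) y ≤ (∑ j, A i j * Real.exp (C j)) * ‖y‖ ^ (-(2 + δ)) := by
    have hy0 : 0 < ‖y‖ := by linarith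
    rw [hu_lap, Finset.sum_mul]
    refine Finset.sum_le_sum fun j _ => ?_
    rw [mul_assoc]
    refine mul_le_mul_of_nonneg_left ?_ (hA_nonneg i j)
    rw [Real.rpow_def_of_pos hy0, Real.rpow_def_of_pos hy0, ← Real.exp_add, ← Real.exp_add,
      Real.exp_le_exp]
    have h1 := hC j y hy
    have h2 := mul_le_mul_of_nonneg_right (hδm j) (Real.log_nonneg hy)
    linarith
  obtain ⟨C₁, hC₁⟩ := hupper i
  obtain ⟨C₂, hC₂⟩ := (hu i).exists_mul_log_le hδ0 hδ1 hdecay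
  rw [hu_mass] at hC₂
  refine ⟨max C₁ C₂, fun y hy => abs_le.2 ⟨?_, ?_⟩⟩
  · linarith [hC₁ y hy, le_max_left C₁ C₂]
  · linarith [hC₂ y hy, le_max_right C₁ C₂]
end
end

section
/- Let A = (a_{ij}) be an n×n matrix satisfying (H1) and (H2). Let μ > 0 and let σ = (σ_1,…,σ_n) ∈ ℝ^n with σ_i ≥ 0 for all i. Suppose there is a nonempty subset I₁ ⊆ {1,…,n} such that σ_i = 0 for all i ∉ I₁ and Σ_{j=1}^n a_{ij} σ_j > 2μ for all i ∈ I₁. Then Σ_{j=1}^n a_{ij} σ_j > 2μ for every i ∈ {1,…,n}. -/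
/-- An n×n real matrix `A` satisfies (H1) if it is symmetric, has all entries nonnegative,
is irreducible, and is invertible. -/
def H1 {n : ℕ} (A : Matrix (Fin n) (Fin n) ℝ) : Prop :=
  A.IsSymm ∧ (∀ i j, 0 ≤ A i j) ∧
  (¬ ∃ S : Finset (Fin n), S.Nonempty ∧ Sᶜ.Nonempty ∧ ∀ i ∈ S, ∀ j ∈ Sᶜ, A i j = 0) ∧
  IsUnit A.det

/-- An n×n real matrix `A` satisfies (H2) if its inverse `A⁻¹ = (aⁱʲ)` satisfies
`aⁱⁱ ≤ 0`, `aⁱʲ ≥ 0` for `i ≠ j`, and all row sums of `A⁻¹` are nonnegative. -/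
def H2 {n : ℕ} (A : Matrix (Fin n) (Fin n) ℝ) : Prop :=
  (∀ i, A⁻¹ i i ≤ 0) ∧ (∀ i j, i ≠ j → 0 ≤ A⁻¹ i j) ∧ (∀ i, 0 ≤ ∑ j, A⁻¹ i j)

/-- If a symmetric invertible matrix has an inverse whose `S × Sᶜ` block vanishes, then its own
`S × Sᶜ` block vanishes. -/
lemma Matrix.IsSymm.eq_zero_of_inv_eq_zero {ι K : Type*} [Fintype ι] [DecidableEq ι] [Field K]
    {A : Matrix ι ι K} (hA : A.IsSymm) (hdet : IsUnit A.det) {S : Finset ι}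
    (h : ∀ i ∈ S, ∀ j ∉ S, A⁻¹ i j = 0) {i j : ι} (hi : i ∈ S) (hj : j ∉ S) :
    A i j = 0 := by
  have hsymm : ∀ i j, A⁻¹ i j = A⁻¹ j i := by
    intro i j
    have hT : A⁻¹.transpose = A⁻¹ := by rw [Matrix.transpose_nonsing_inv, hA.eq]
    exact congrFun (congrFun hT j) i
  set D : Matrix ι ι K := Matrix.diagonal fun k => if k ∈ S then 1 else 0 with hD
  have hcomm : D * A⁻¹ = A⁻¹ * D := by
    ext k l
    rw [hD, Matrix.diagonal_mul, Matrix.mul_diagonal]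
    by_cases hk : k ∈ S <;> by_cases hl : l ∈ S
    · simp [hk, hl]
    · simp [hk, hl, h k hk l hl]
    · simp [hk, hl, hsymm k l, h l hl k hk]
    · simp [hk, hl]
  have hcomm' : A * D = D * A := by
    calc A * D = A * (D * A⁻¹) * A := by
          rw [Matrix.mul_assoc, Matrix.mul_assoc, Matrix.nonsing_inv_mul A hdet, Matrix.mul_one]
      _ = D * A := by
          rw [hcomm, ← Matrix.mul_assoc, Matrix.mul_nonsing_inv A hdet, Matrix.one_mul]
  have hij := congrFun (congrFun hcomm' i) j
  rw [hD, Matrix.diagonal_mul, Matrix.mul_diagonal] at hij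
  simpa [hi, hj] using hij.symm

/-- the lower bound `Σⱼ aᵢⱼ σⱼ > 2μ`, valid on a nonempty set `I₁` of indices
outside of which `σ` vanishes, extends to all indices. -/
theorem extend_lower_bound {n : ℕ} (A : Matrix (Fin n) (Fin n) ℝ)
    (hA1 : H1 A) (hA2 : H2 A) (μ : ℝ) (hμ : 0 < μ)
    (σ : Fin n → ℝ) (hσ : ∀ i, 0 ≤ σ i)
    (I₁ : Finset (Fin n)) (hI₁ : I₁.Nonempty)
    (hzero : ∀ i ∉ I₁, σ i = 0)
    (hbig : ∀ i ∈ I₁, 2 * μ < ∑ j, A i j * σ j) :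
    ∀ i, 2 * μ < ∑ j, A i j * σ j := by
  obtain ⟨hsymm, hnonneg, hirr, hdet⟩ := hA1
  obtain ⟨-, hoff, hrow⟩ := hA2
  set m : Fin n → ℝ := fun i => ∑ j, A i j * σ j with hm
  have hinv : ∀ i, ∑ j, A⁻¹ i j * m j = σ i := by
    have hmul : A⁻¹.mulVec (A.mulVec σ) = σ := by
      rw [Matrix.mulVec_mulVec, Matrix.nonsing_inv_mul A hdet, Matrix.one_mulVec]
    exact fun i => congrFun hmul i
  obtain ⟨i₁, hi₁⟩ := hI₁
  obtain ⟨k, -, hk⟩ := Finset.exists_min_image Finset.univ m ⟨i₁, Finset.mem_univ i₁⟩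
  have hmk : 0 ≤ m k := Finset.sum_nonneg fun j _ => mul_nonneg (hnonneg k j) (hσ j)
  suffices hlt : 2 * μ < m k from fun i => hlt.trans_le (hk i (Finset.mem_univ i))
  by_contra! hle
  set S : Finset (Fin n) := Finset.univ.filter fun i => m i = m k with hS
  have hmem : ∀ i, i ∈ S ↔ m i = m k := by simp [hS]
  have hblock : ∀ i ∈ S, ∀ j ∉ S, A⁻¹ i j = 0 := by
    intro i hi j hj
    have him := (hmem i).1 hi
    have hiI : i ∉ I₁ := fun hmemI => (hbig i hmemI).not_ge (him.trans_le hle)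
    have hterm : ∀ l ∈ Finset.univ, 0 ≤ A⁻¹ i l * (m l - m k) := by
      intro l _
      rcases eq_or_ne i l with rfl | hil
      · simp [him]
      · exact mul_nonneg (hoff i l hil) (sub_nonneg.2 (hk l (Finset.mem_univ l)))
    have hsum : ∑ l, A⁻¹ i l * (m l - m k) = -((∑ l, A⁻¹ i l) * m k) := by
      simp only [mul_sub, Finset.sum_sub_distrib, hinv i, hzero i hiI, Finset.sum_mul, zero_sub]
    have hsum_zero : ∑ l, A⁻¹ i l * (m l - m k) = 0 :=
      le_antisymm (hsum ▸ neg_nonpos.2 (mul_nonneg (hrow i) hmk)) (Finset.sum_nonneg hterm)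
    have hj0 := (Finset.sum_eq_zero_iff_of_nonneg hterm).1 hsum_zero j (Finset.mem_univ j)
    exact (mul_eq_zero.1 hj0).resolve_right (sub_ne_zero.2 fun h => hj ((hmem j).2 h))
  refine hirr ⟨S, ⟨k, (hmem k).2 rfl⟩, ⟨i₁, Finset.mem_compl.2 fun h => ?_⟩, fun i hi j hj => ?_⟩
  · exact (hbig i₁ hi₁).not_ge (((hmem i₁).1 h).trans_le hle)
  · exact hsymm.eq_zero_of_inv_eq_zero hdet hblock hi (Finset.mem_compl.1 hj)
end

section
/- Let A = (a_{ij}) be an n×n matrix satisfying (H1). Let μ > 0 and let σ⁽¹⁾ = (σ_1⁽¹⁾,…,σ_n⁽¹⁾) and σ⁽²⁾ = (σ_1⁽²⁾,…,σ_n⁽²⁾) be two vectors with nonnegative components, both satisfying the Pohozaev identity Σ_{i,j=1}^n a_{ij} σ_i⁽ˡ⁾ σ_j⁽ˡ⁾ = 4μ Σ_{i=1}^n σ_i⁽ˡ⁾ for l = 1, 2. If Σ_{j=1}^n a_{ij} σ_j⁽¹⁾ > 2μ for every i = 1,…,n, and σ_i⁽²⁾ ≥ σ_i⁽¹⁾ for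 every i, then σ_i⁽¹⁾ = σ_i⁽²⁾ for every i = 1,…,n. -/
/-- Expansion of a symmetric quadratic form around a base point. -/
theorem Matrix.IsSymm.sum_mul_mul_eq_add {n : ℕ} {A : Matrix (Fin n) (Fin n) ℝ}
    (hA : A.IsSymm) (x y : Fin n → ℝ) :
    ∑ i, ∑ j, A i j * y i * y j =
      ∑ i, ∑ j, A i j * x i * x j + 2 * ∑ i, (y i - x i) * ∑ j, A i j * x j
        + ∑ i, ∑ j, A i j * (y i - x i) * (y j - x j) := by
  have hswap : ∑ i, (y i - x i) * ∑ j, A i j * x j =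
      ∑ i, ∑ j, A i j * x i * (y j - x j) := by
    simp_rw [Finset.mul_sum]
    rw [Finset.sum_comm]
    refine Finset.sum_congr rfl fun i _ => Finset.sum_congr rfl fun j _ => ?_
    rw [hA.apply i j]
    ring
  rw [two_mul]
  nth_rewrite 1 [hswap]
  simp_rw [Finset.mul_sum, ← Finset.sum_add_distrib]
  refine Finset.sum_congr rfl fun i _ => Finset.sum_congr rfl fun j _ => ?_
  ring

/-- if two nonnegative vectors both satisfy the Pohozaev identity, the first one
has all "decay rates" `Σⱼ aᵢⱼ σⱼ⁽¹⁾ > 2μ`, and the second dominates the first componentwise,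
then the two vectors coincide. -/
theorem pohozaev_rigidity {n : ℕ} (A : Matrix (Fin n) (Fin n) ℝ) (hA1 : H1 A)
    (μ : ℝ) (hμ : 0 < μ) (σ₁ σ₂ : Fin n → ℝ)
    (hσ₁ : ∀ i, 0 ≤ σ₁ i) (hσ₂ : ∀ i, 0 ≤ σ₂ i)
    (hpoh₁ : ∑ i, ∑ j, A i j * σ₁ i * σ₁ j = 4 * μ * ∑ i, σ₁ i)
    (hpoh₂ : ∑ i, ∑ j, A i j * σ₂ i * σ₂ j = 4 * μ * ∑ i, σ₂ i)
    (hbig : ∀ i, 2 * μ < ∑ j, A i j * σ₁ j)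
    (hdom : ∀ i, σ₁ i ≤ σ₂ i) :
    ∀ i, σ₁ i = σ₂ i := by
  have hquad : 0 ≤ ∑ i, ∑ j, A i j * (σ₂ i - σ₁ i) * (σ₂ j - σ₁ j) :=
    Finset.sum_nonneg fun i _ => Finset.sum_nonneg fun j _ =>
      mul_nonneg (mul_nonneg (hA1.2.1 i j) (sub_nonneg.2 (hdom i))) (sub_nonneg.2 (hdom j))
  have hnonneg : ∀ i ∈ Finset.univ,
      0 ≤ (σ₂ i - σ₁ i) * (∑ j, A i j * σ₁ j - 2 * μ) := fun i _ =>
    mul_nonneg (sub_nonneg.2 (hdom i)) (sub_nonneg.2 (hbig i).le)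
  have hsplit : ∑ i, (σ₂ i - σ₁ i) * (∑ j, A i j * σ₁ j - 2 * μ) =
      ∑ i, (σ₂ i - σ₁ i) * ∑ j, A i j * σ₁ j - 2 * μ * (∑ i, σ₂ i - ∑ i, σ₁ i) := by
    rw [← Finset.sum_sub_distrib, Finset.mul_sum, ← Finset.sum_sub_distrib]
    exact Finset.sum_congr rfl fun i _ => by ring
  have hzero : ∑ i, (σ₂ i - σ₁ i) * (∑ j, A i j * σ₁ j - 2 * μ) = 0 := by
    have hexp := hA1.1.sum_mul_mul_eq_add σ₁ σ₂
    refine le_antisymm ?_ (Finset.sum_nonneg hnonneg)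
    linarith
  intro i
  rcases mul_eq_zero.1 ((Finset.sum_eq_zero_iff_of_nonneg hnonneg).1 hzero i (Finset.mem_univ i))
    with h | h
  · linarith
  · linarith [hbig i]
end

section
/- Let A = (a_{ij}) be an n×n matrix (n ≥ 2) satisfying (H1) and (H2). Then a_{ij} > 0 for all i ≠ j. -/
/-- A nonsingular matrix is block diagonal with respect to `Z`, `Zᶜ` as soon as its inverse is. -/
theorem Matrix.apply_eq_zero_of_inv_block {ι : Type*} [Fintype ι] [DecidableEq ι]
    {A B : Matrix ι ι ℝ} (hAB : A * B = 1) (hBA : B * A = 1) (Z : Finset ι)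
    (h₁ : ∀ i ∈ Z, ∀ j ∉ Z, B i j = 0) (h₂ : ∀ i ∉ Z, ∀ j ∈ Z, B i j = 0)
    {i j : ι} (hi : i ∈ Z) (hj : j ∉ Z) : A i j = 0 := by
  let D : Matrix ι ι ℝ := Matrix.diagonal fun k => if k ∈ Z then 1 else 0
  have hD : D * B = B * D := by
    ext k l
    rw [Matrix.diagonal_mul, Matrix.mul_diagonal]
    by_cases hk : k ∈ Z <;> by_cases hl : l ∈ Z <;> simp_all
  have hDA : D * A = A * D := by
    calc D * A = A * B * (D * A) := by rw [hAB, one_mul]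
      _ = A * (B * D) * A := by simp only [mul_assoc]
      _ = A * D * (B * A) := by rw [← hD]; simp only [mul_assoc]
      _ = A * D := by rw [hBA, mul_one]
  have h := congrFun (congrFun hDA i) j
  rw [Matrix.diagonal_mul, Matrix.mul_diagonal] at h
  simpa [hi, hj] using h

/-- If `B * A = 1` with `A` entrywise nonnegative and `B` nonnegative off the diagonal, then a zero
off-diagonal entry `A i j` forces all products `B i k * A k j` to vanish. -/
theorem Matrix.mul_apply_eq_zero_of_apply_eq_zero {ι : Type*} [Fintype ι] [DecidableEq ι]
    {A B : Matrix ι ι ℝ} (hBA : B * A = 1) (hA : ∀ i j, 0 ≤ A i j)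
    (hB : ∀ i j, i ≠ j → 0 ≤ B i j) {i j : ι} (hij : i ≠ j) (h : A i j = 0) (k : ι) :
    B i k * A k j = 0 := by
  have hs : ∑ k, B i k * A k j = 0 := by
    rw [← Matrix.mul_apply, hBA, Matrix.one_apply_ne hij]
  refine (Finset.sum_eq_zero_iff_of_nonneg fun k _ => ?_).1 hs k (Finset.mem_univ k)
  rcases eq_or_ne i k with rfl | hik
  · simp [h]
  · exact mul_nonneg (hB i k hik) (hA k j)

/-- if an n×n matrix (n ≥ 2) satisfies (H1) and (H2), then all its
off-diagonal entries are strictly positive. -/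
theorem offdiag_pos {n : ℕ} (hn : 2 ≤ n) (A : Matrix (Fin n) (Fin n) ℝ)
    (hA1 : H1 A) (hA2 : H2 A) :
    ∀ i j, i ≠ j → 0 < A i j := by
  obtain ⟨hsymm, hA, hirr, hdet⟩ := hA1
  obtain ⟨-, hB, -⟩ := hA2
  intro i j hij
  by_contra hpos
  have hij0 : A i j = 0 := le_antisymm (not_lt.1 hpos) (hA i j)
  have hAB : A * A⁻¹ = 1 := Matrix.mul_nonsing_inv A hdet
  have hBA : A⁻¹ * A = 1 := Matrix.nonsing_inv_mul A hdet
  have hBsymm : ∀ k l, A⁻¹ k l = A⁻¹ l k := fun k l => by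
    have h : (A⁻¹).transpose = A⁻¹ := by rw [Matrix.transpose_nonsing_inv, hsymm.eq]
    exact congrFun (congrFun h.symm k) l
  have key := fun {k l : Fin n} =>
    Matrix.mul_apply_eq_zero_of_apply_eq_zero hBA hA hB (i := k) (j := l)
  let Z : Finset (Fin n) := Finset.univ.filter fun k => k ≠ j ∧ A k j = 0
  have hZ : ∀ k, k ∈ Z ↔ k ≠ j ∧ A k j = 0 := fun k => by simp [Z]
  have hZP : ∀ z ∈ Z, ∀ k, A k j ≠ 0 → A⁻¹ z k = 0 := fun z hz k hk =>
    (mul_eq_zero.1 (key ((hZ z).1 hz).1 ((hZ z).1 hz).2 k)).resolve_right hk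
  have hZj : ∀ z ∈ Z, A⁻¹ j z = 0 := fun z hz => by
    have hs : ∑ m, A z m * A⁻¹ m z = 1 := by
      rw [← Matrix.mul_apply, hAB, Matrix.one_apply_eq]
    rw [← mul_one (A⁻¹ j z), ← hs, Finset.mul_sum]
    refine Finset.sum_eq_zero fun m _ => ?_
    by_cases hmj : m = j
    · rw [hmj, ((hZ z).1 hz).2, zero_mul, mul_zero]
    by_cases hm : A m j = 0
    · rw [← mul_assoc, key (Ne.symm hmj) ((hsymm.apply m j).trans hm) z, zero_mul]
    · rw [hBsymm m z, hZP z hz m hm, mul_zero, mul_zero]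
  have hblock : ∀ z ∈ Z, ∀ k ∉ Z, A⁻¹ z k = 0 := fun z hz k hk => by
    rcases eq_or_ne k j with rfl | hkj
    · rw [hBsymm, hZj z hz]
    · exact hZP z hz k fun h => hk ((hZ k).2 ⟨hkj, h⟩)
  refine hirr ⟨Z, ⟨i, (hZ i).2 ⟨hij, hij0⟩⟩, ⟨j, by simp [hZ]⟩, fun z hz k hk => ?_⟩
  exact Matrix.apply_eq_zero_of_inv_block hAB hBA Z hblock
    (fun k hk z hz => by rw [hBsymm, hblock z hz k hk]) hz (Finset.mem_compl.1 hk)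
end

section
/- Let A = (a_{ij}) be an n×n matrix satisfying (H1) and (H2), with inverse A⁻¹ = (a^{ij}). Let J be a nonempty proper subset of {1,…,n}. Suppose m = (m_1,…,m_n) ∈ ℝ^n has m_i > 0 for every i and satisfies Σ_{j=1}^n a^{ij} m_j = 0 for every i ∈ J. Then for every choice of positive numbers δ_j > 0 (j ∈ J) there exists an index ĩ ∈ J such that Σ_{j∈J} a^{ĩj} δ_j < 0. -/
/-- if `m` is a positive vector with `(A⁻¹ m)ᵢ = 0` for all `i` in a nonempty
proper subset `J`, then for any positive weights `δⱼ` (j ∈ J) some row `ĩ ∈ J` of `A⁻¹`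
pairs negatively with them over `J`. -/
theorem neg_pairing {n : ℕ} (A : Matrix (Fin n) (Fin n) ℝ)
    (hA1 : H1 A) (hA2 : H2 A)
    (J : Finset (Fin n)) (hJne : J.Nonempty) (hJprop : J ≠ Finset.univ)
    (m : Fin n → ℝ) (hm : ∀ i, 0 < m i)
    (hzero : ∀ i ∈ J, ∑ j, A⁻¹ i j * m j = 0) :
    ∀ δ : Fin n → ℝ, (∀ j ∈ J, 0 < δ j) →
      ∃ i ∈ J, ∑ j ∈ J, A⁻¹ i j * δ j < 0 := by
  intro δ hδ
  by_contra! hcon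
  obtain ⟨hsymm, -, -, hdet⟩ := hA1
  obtain ⟨-, hoff, -⟩ := hA2
  have hBsymm : ∀ i j, A⁻¹ i j = A⁻¹ j i := fun i j =>
    (show (A⁻¹).IsSymm by rw [Matrix.IsSymm, Matrix.transpose_nonsing_inv, hsymm]).apply j i
  have hsplit : ∀ i ∈ J, ∑ j ∈ J, A⁻¹ i j * m j = -∑ j ∈ Jᶜ, A⁻¹ i j * m j := fun i hi => by
    linarith [hzero i hi, Finset.sum_add_sum_compl J fun j => A⁻¹ i j * m j]
  have hnonneg : ∀ i ∈ J, ∀ j ∈ Jᶜ, 0 ≤ A⁻¹ i j * m j := fun i hi j hj =>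
    mul_nonneg (hoff i j fun h => Finset.mem_compl.1 hj (h ▸ hi)) (hm j).le
  have hle : ∀ i ∈ J, ∑ j ∈ J, A⁻¹ i j * m j ≤ 0 := fun i hi => by
    rw [hsplit i hi]
    exact neg_nonpos.2 (Finset.sum_nonneg (hnonneg i hi))
  have hpair : ∑ i ∈ J, δ i * ∑ j ∈ J, A⁻¹ i j * m j
      = ∑ i ∈ J, m i * ∑ j ∈ J, A⁻¹ i j * δ j := by
    simp only [Finset.mul_sum]
    rw [Finset.sum_comm]
    refine Finset.sum_congr rfl fun i _ => Finset.sum_congr rfl fun j _ => ?_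
    rw [hBsymm j i]
    ring
  have hterm : ∀ i ∈ J, δ i * ∑ j ∈ J, A⁻¹ i j * m j ≤ 0 := fun i hi =>
    mul_nonpos_of_nonneg_of_nonpos (hδ i hi).le (hle i hi)
  have hsum : ∑ i ∈ J, δ i * ∑ j ∈ J, A⁻¹ i j * m j = 0 :=
    le_antisymm (Finset.sum_nonpos hterm)
      (hpair ▸ Finset.sum_nonneg fun i hi => mul_nonneg (hm i).le (hcon i hi))
  have hJzero : ∀ i ∈ J, ∑ j ∈ J, A⁻¹ i j * m j = 0 := fun i hi =>
    (mul_eq_zero.1 ((Finset.sum_eq_zero_iff_of_nonpos hterm).1 hsum i hi)).resolve_left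
      (hδ i hi).ne'
  have hblock : ∀ i ∈ J, ∀ j ∈ Jᶜ, A⁻¹ i j = 0 := fun i hi j hj => by
    have h : ∑ j ∈ Jᶜ, A⁻¹ i j * m j = 0 := by linarith [hsplit i hi, hJzero i hi]
    exact (mul_eq_zero.1 ((Finset.sum_eq_zero_iff_of_nonneg (hnonneg i hi)).1 h j hj)).resolve_right
      (hm j).ne'
  have hker : A⁻¹.mulVec (fun j => if j ∈ J then m j else 0) = 0 := by
    ext i
    simp only [Matrix.mulVec, dotProduct, mul_ite, mul_zero, Finset.sum_ite_mem,
      Finset.univ_inter, Pi.zero_apply]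
    by_cases hi : i ∈ J
    · exact hJzero i hi
    · refine Finset.sum_eq_zero fun j hj => ?_
      rw [hBsymm i j, hblock j hj i (Finset.mem_compl.2 hi), zero_mul]
  have hres := congrArg A.mulVec hker
  rw [Matrix.mulVec_mulVec, Matrix.mul_nonsing_inv A hdet, Matrix.one_mulVec,
    Matrix.mulVec_zero] at hres
  obtain ⟨k, hk⟩ := hJne
  have hmk := congrFun hres k
  simp only [hk, if_true, Pi.zero_apply] at hmk
  exact (hm k).ne' hmk
end

section
/- Let A be an n×n matrix satisfying (H1) and (H2), with inverse A⁻¹ = (a^{ij}). Then Σ_{i,j=1}^n a^{ij} > 0. -/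
/-- if `A` satisfies (H1) and (H2) then the sum of all entries of `A⁻¹`
is strictly positive. -/
theorem inv_entries_sum_pos {n : ℕ} (hn : 0 < n) (A : Matrix (Fin n) (Fin n) ℝ)
    (hA1 : H1 A) (hA2 : H2 A) :
    0 < ∑ i, ∑ j, A⁻¹ i j := by
  obtain ⟨-, -, -, hdet⟩ := hA1
  obtain ⟨-, -, hrow⟩ := hA2
  refine lt_of_le_of_ne (Finset.sum_nonneg fun i _ => hrow i) fun hsum => ?_
  have hzero := (Finset.sum_eq_zero_iff_of_nonneg fun i _ => hrow i).1 hsum.symm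
  have hker : A⁻¹.mulVec (fun _ => (1 : ℝ)) = 0 := by
    ext i
    simpa [Matrix.mulVec, dotProduct] using hzero i (Finset.mem_univ i)
  have hone : (fun _ : Fin n => (1 : ℝ)) = 0 := by
    rw [← Matrix.one_mulVec (fun _ : Fin n => (1 : ℝ)), ← Matrix.mul_nonsing_inv A hdet,
      ← Matrix.mulVec_mulVec, hker, Matrix.mulVec_zero]
  exact one_ne_zero (congrFun hone ⟨0, hn⟩)
end

section
/- Let A = [[a_{11}, a_{12}], [a_{12}, a_{22}]] be a symmetric 2×2 real matrix. Then A satisfies (H1) and (H2) if and only if a_{11} ≥ 0, a_{22} ≥ 0, a_{12} ≥ 0, max(a_{11}, a_{22}) ≤ a_{12}, and det(A) ≠ 0. -/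
/-- The inverse of a symmetric 2×2 real matrix, by Cramer's rule. -/
theorem inv_symm_two (a b c : ℝ) :
    (!![a, b; b, c] : Matrix (Fin 2) (Fin 2) ℝ)⁻¹ =
      !![c / (a * c - b * b), -b / (a * c - b * b);
        -b / (a * c - b * b), a / (a * c - b * b)] := by
  rw [Matrix.inv_def, Matrix.adjugate_fin_two_of, Matrix.det_fin_two_of, Ring.inverse_eq_inv']
  ext i j
  fin_cases i <;> fin_cases j <;> simp [div_eq_inv_mul]

theorem H1_two_iff (a b c : ℝ) :
    H1 !![a, b; b, c] ↔ 0 ≤ a ∧ 0 < b ∧ 0 ≤ c ∧ a * c - b * b ≠ 0 := by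
  rw [H1, Matrix.det_fin_two_of, isUnit_iff_ne_zero]
  constructor
  · rintro ⟨-, hnn, hirr, hdet⟩
    have hb : b ≠ 0 := by
      rintro rfl
      refine hirr ⟨{0}, ⟨0, by simp⟩, ⟨1, by simp⟩, fun i hi j hj => ?_⟩
      fin_cases i <;> fin_cases j <;> simp_all
    exact ⟨hnn 0 0, lt_of_le_of_ne (hnn 0 1) hb.symm, hnn 1 1, hdet⟩
  · rintro ⟨ha, hb, hc, hdet⟩
    refine ⟨?_, fun i j => ?_, ?_, hdet⟩
    · ext i j
      fin_cases i <;> fin_cases j <;> rfl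
    · fin_cases i <;> fin_cases j <;> simp [ha, hb.le, hc]
    · rintro ⟨S, ⟨i, hi⟩, ⟨j, hj⟩, h⟩
      have hij := h i hi j hj
      have hne : i ≠ j := fun e => Finset.mem_compl.mp hj (e ▸ hi)
      fin_cases i <;> fin_cases j <;> simp_all

theorem H2_two_iff {a b c : ℝ} (ha : 0 ≤ a) (hb : 0 < b) (hc : 0 ≤ c)
    (hdet : a * c - b * b ≠ 0) : H2 !![a, b; b, c] ↔ a ≤ b ∧ c ≤ b := by
  rw [H2, inv_symm_two]
  set d := a * c - b * b with hd
  constructor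
  · rintro ⟨-, hoff, hrow⟩
    have h01 : 0 ≤ -b / d := hoff 0 1 (by decide)
    have hneg : d < 0 := by
      by_contra! hpos
      exact (div_neg_of_neg_of_pos (neg_neg_of_pos hb) (hpos.lt_of_ne' hdet)).not_ge h01
    have h0 := hrow 0
    have h1 := hrow 1
    simp only [Fin.sum_univ_two, Matrix.of_apply, Matrix.cons_val_zero, Matrix.cons_val_one,
      ← add_div, le_div_iff_of_neg hneg, zero_mul] at h0 h1
    constructor <;> linarith
  · rintro ⟨hab, hcb⟩
    have hneg : d < 0 := by
      refine lt_of_le_of_ne ?_ hdet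
      linarith [mul_le_mul hab hcb hc hb.le]
    refine ⟨fun i => ?_, fun i j hij => ?_, fun i => ?_⟩
    · fin_cases i
      · exact div_nonpos_of_nonneg_of_nonpos hc hneg.le
      · exact div_nonpos_of_nonneg_of_nonpos ha hneg.le
    · have h : 0 ≤ -b / d := div_nonneg_of_nonpos (by linarith) hneg.le
      fin_cases i <;> fin_cases j <;> first | exact h | exact absurd rfl hij
    · rw [Fin.sum_univ_two]
      fin_cases i
      · change 0 ≤ c / d + -b / d
        rw [← add_div]
        exact div_nonneg_of_nonpos (by linarith) hneg.le
      · change 0 ≤ -b / d + a / d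
        rw [← add_div]
        exact div_nonneg_of_nonpos (by linarith) hneg.le

/-- characterization of 2×2 matrices satisfying (H1) and (H2). -/
theorem two_by_two_H1_H2 (a₁₁ a₁₂ a₂₂ : ℝ) :
    (H1 !![a₁₁, a₁₂; a₁₂, a₂₂] ∧ H2 !![a₁₁, a₁₂; a₁₂, a₂₂]) ↔
      (0 ≤ a₁₁ ∧ 0 ≤ a₂₂ ∧ 0 ≤ a₁₂ ∧ max a₁₁ a₂₂ ≤ a₁₂ ∧
        Matrix.det !![a₁₁, a₁₂; a₁₂, a₂₂] ≠ 0) := by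
  rw [H1_two_iff, Matrix.det_fin_two_of, max_le_iff]
  constructor
  · rintro ⟨⟨ha, hb, hc, hdet⟩, h2⟩
    exact ⟨ha, hc, hb.le, (H2_two_iff ha hb hc hdet).mp h2, hdet⟩
  · rintro ⟨ha, hc, hb, hle, hdet⟩
    have hb' : 0 < a₁₂ := by
      refine lt_of_le_of_ne hb ?_
      rintro rfl
      exact hdet (by simp [le_antisymm hle.1 ha])
    exact ⟨⟨ha, hb', hc, hdet⟩, (H2_two_iff ha hb' hc hdet).mpr hle⟩
end

section
/- Let a_1, a_2, a_3 be real numbers and let A₁ be the 3×3 symmetric matrix with zero diagonal and off-diagonal entries A₁ = [[0, a_1, a_2], [a_1, 0, a_3], [a_2, a_3, 0]]. Then A₁ satisfies both (H1) and (H2) if and only if a_1 > 0, a_2 > 0, a_3 > 0, and a_i + a_j ≥ a_k for every choice of pairwise distinct indices i, j, k ∈ {1, 2, 3}. -/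
/-- Closed form of the determinant of a hollow symmetric `3 × 3` matrix. -/
theorem det_hollow_three (a₁ a₂ a₃ : ℝ) :
    (!![0, a₁, a₂; a₁, 0, a₃; a₂, a₃, 0] : Matrix (Fin 3) (Fin 3) ℝ).det = 2 * (a₁ * a₂ * a₃) := by
  rw [Matrix.det_fin_three]
  simp
  ring

/-- Closed form of the inverse of a hollow symmetric `3 × 3` matrix. -/
theorem inv_hollow_three (a₁ a₂ a₃ : ℝ) (h₁ : a₁ ≠ 0) (h₂ : a₂ ≠ 0) (h₃ : a₃ ≠ 0) :
    (!![0, a₁, a₂; a₁, 0, a₃; a₂, a₃, 0] : Matrix (Fin 3) (Fin 3) ℝ)⁻¹ =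
      (2 * (a₁ * a₂ * a₃))⁻¹ •
        !![-(a₃ * a₃), a₂ * a₃, a₁ * a₃; a₂ * a₃, -(a₂ * a₂), a₁ * a₂;
          a₁ * a₃, a₁ * a₂, -(a₁ * a₁)] := by
  apply Matrix.inv_eq_right_inv
  ext i j
  fin_cases i <;> fin_cases j <;> simp [Matrix.mul_apply, Fin.sum_univ_three] <;> field_simp <;>
    ring

/-- The row sums of the inverse of a hollow symmetric `3 × 3` matrix with positive off-diagonal
entries are nonnegative exactly when these entries satisfy the triangle inequalities. -/
theorem inv_hollow_three_row_sum_nonneg_iff (a₁ a₂ a₃ : ℝ) (h₁ : 0 < a₁) (h₂ : 0 < a₂)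
    (h₃ : 0 < a₃) :
    (∀ i, 0 ≤ ∑ j, (!![0, a₁, a₂; a₁, 0, a₃; a₂, a₃, 0] : Matrix (Fin 3) (Fin 3) ℝ)⁻¹ i j) ↔
      (a₁ + a₂ ≥ a₃ ∧ a₁ + a₃ ≥ a₂ ∧ a₂ + a₃ ≥ a₁) := by
  have hd : 0 < (2 * (a₁ * a₂ * a₃))⁻¹ := by positivity
  rw [inv_hollow_three a₁ a₂ a₃ h₁.ne' h₂.ne' h₃.ne']
  generalize (2 * (a₁ * a₂ * a₃))⁻¹ = d at hd
  have e₀ : d * -(a₃ * a₃) + d * (a₂ * a₃) + d * (a₁ * a₃) = d * a₃ * (a₁ + a₂ - a₃) := by ring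
  have e₁ : d * (a₂ * a₃) + d * -(a₂ * a₂) + d * (a₁ * a₂) = d * a₂ * (a₁ + a₃ - a₂) := by ring
  have e₂ : d * (a₁ * a₃) + d * (a₁ * a₂) + d * -(a₁ * a₁) = d * a₁ * (a₂ + a₃ - a₁) := by ring
  simp only [Fin.forall_fin_succ, Fin.sum_univ_three, Matrix.smul_apply, smul_eq_mul]
  change 0 ≤ d * -(a₃ * a₃) + d * (a₂ * a₃) + d * (a₁ * a₃) ∧
    0 ≤ d * (a₂ * a₃) + d * -(a₂ * a₂) + d * (a₁ * a₂) ∧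
    0 ≤ d * (a₁ * a₃) + d * (a₁ * a₂) + d * -(a₁ * a₁) ∧ _ ↔ _
  rw [e₀, e₁, e₂, mul_nonneg_iff_of_pos_left (mul_pos hd h₃),
    mul_nonneg_iff_of_pos_left (mul_pos hd h₂), mul_nonneg_iff_of_pos_left (mul_pos hd h₁)]
  simp

/-- characterization of 3×3 symmetric matrices with zero diagonal
satisfying (H1) and (H2). -/
theorem three_by_three_H1_H2 (a₁ a₂ a₃ : ℝ) :
    (H1 !![0, a₁, a₂; a₁, 0, a₃; a₂, a₃, 0] ∧ H2 !![0, a₁, a₂; a₁, 0, a₃; a₂, a₃, 0]) ↔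
      (0 < a₁ ∧ 0 < a₂ ∧ 0 < a₃ ∧ a₁ + a₂ ≥ a₃ ∧ a₁ + a₃ ≥ a₂ ∧ a₂ + a₃ ≥ a₁) := by
  constructor
  · rintro ⟨⟨-, hnn, -, hdet⟩, -, -, hrow⟩
    rw [det_hollow_three, isUnit_iff_ne_zero] at hdet
    simp only [ne_eq, mul_eq_zero, OfNat.ofNat_ne_zero, false_or, not_or] at hdet
    obtain ⟨⟨n₁, n₂⟩, n₃⟩ := hdet
    have h₁ : 0 < a₁ := lt_of_le_of_ne (hnn 0 1) (Ne.symm n₁)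
    have h₂ : 0 < a₂ := lt_of_le_of_ne (hnn 0 2) (Ne.symm n₂)
    have h₃ : 0 < a₃ := lt_of_le_of_ne (hnn 1 2) (Ne.symm n₃)
    exact ⟨h₁, h₂, h₃, (inv_hollow_three_row_sum_nonneg_iff a₁ a₂ a₃ h₁ h₂ h₃).1 hrow⟩
  · rintro ⟨h₁, h₂, h₃, htri⟩
    refine ⟨⟨?_, ?_, ?_, ?_⟩, ?_, ?_,
      (inv_hollow_three_row_sum_nonneg_iff a₁ a₂ a₃ h₁ h₂ h₃).2 htri⟩
    · ext i j
      fin_cases i <;> fin_cases j <;> rfl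
    · intro i j
      fin_cases i <;> fin_cases j <;> simp [h₁.le, h₂.le, h₃.le]
    · rintro ⟨S, ⟨i, hi⟩, ⟨j, hj⟩, hS⟩
      have hij : i ≠ j := by
        rintro rfl
        exact Finset.mem_compl.1 hj hi
      have hz := hS i hi j hj
      fin_cases i <;> fin_cases j <;> simp [h₁.ne', h₂.ne', h₃.ne'] at hz hij
    · rw [det_hollow_three, isUnit_iff_ne_zero]
      positivity
    · intro i
      rw [inv_hollow_three a₁ a₂ a₃ h₁.ne' h₂.ne' h₃.ne', Matrix.smul_apply, smul_eq_mul]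
      refine mul_nonpos_of_nonneg_of_nonpos (by positivity) ?_
      fin_cases i <;> simp [mul_self_nonneg]
    · intro i j hij
      rw [inv_hollow_three a₁ a₂ a₃ h₁.ne' h₂.ne' h₃.ne', Matrix.smul_apply, smul_eq_mul]
      refine mul_nonneg (by positivity) ?_
      fin_cases i <;> fin_cases j <;> simp at hij ⊢ <;> positivity
end
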